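/- arXiv:1410.0447 — 8 statements merged into one kernel-verified Lean document; each statement's English description precedes it below -/
import Mathlib

section
/- Let λ ∈ ℂ and λ0 > 0. For functions U1, U2, U3, U4 : ℝ → ℂ with U1 four times differentiable and U3 twice differentiable, write L0 u := u'' − W''(u0) u. Then the eigenvalue system λU1 = U2, λU2 = (1/λ0)(U3 − L0 U1), λU3 = U4, λU4 = −(1/λ0) L0 U3 holds if and only if U2 = λ U1, U3 = (L0 + λ0 λ²) U1, U4 = λ (L0 + λ0 λ²) U1 and (L0 + λ0 λ²)² U1 = 0. Consequently, the projection (U1, U2, U3, U4) ↦ U1 is a linear bijection from the kernel of 𝕃_* − λ onto the kernel of the scalar fourth-order operator (L0 + λ0 λ²)², where 𝕃_* denotes the linear operator defined by the right-hand sides of the above system. -/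
noncomputable section

/-- The scalar linearized operator `L0 u = u'' − W''(u0) u`, acting on complex-valued
functions of the transverse variable `r`. -/
def L0c (W u0 : ℝ → ℝ) (u : ℝ → ℂ) : ℝ → ℂ :=
  fun r => iteratedDeriv 2 u r - ((iteratedDeriv 2 W (u0 r) : ℝ) : ℂ) * u r

/-- The eigenvalue system `λU1 = U2`, `λU2 = (1/lam0)(U3 − L0U1)`, `λU3 = U4`,
`λU4 = −(1/lam0) L0 U3` for the spatial-dynamics linearization `𝕃_*`. -/
def EigSystem (W u0 : ℝ → ℝ) (lam0 : ℝ) (lam : ℂ) (U1 U2 U3 U4 : ℝ → ℂ) : Prop :=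
  (∀ r, lam * U1 r = U2 r) ∧
  (∀ r, lam * U2 r = (1 / (lam0 : ℂ)) * (U3 r - L0c W u0 U1 r)) ∧
  (∀ r, lam * U3 r = U4 r) ∧
  (∀ r, lam * U4 r = -(1 / (lam0 : ℂ)) * L0c W u0 U3 r)

/-- If `u` is `C^4`, then `L0 u + c u` is `C^2`. -/
theorem ContDiff.L0c_add_const_mul {W u0 : ℝ → ℝ} (hW : ContDiff ℝ (⊤ : ℕ∞) W)
    (hu0 : ContDiff ℝ (⊤ : ℕ∞) u0) (c : ℂ) {u : ℝ → ℂ} (hu : ContDiff ℝ 4 u) :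
    ContDiff ℝ 2 (fun r => L0c W u0 u r + c * u r) := by
  have hu2 : ContDiff ℝ 2 u := hu.of_le (by norm_num)
  have hddu : ContDiff ℝ 2 (iteratedDeriv 2 u) := by
    rw [iteratedDeriv_eq_iterate]
    exact ContDiff.iterate_deriv' 2 2 (by norm_num; exact hu)
  have hddW : ContDiff ℝ 2 (iteratedDeriv 2 W) := by
    rw [iteratedDeriv_eq_iterate]
    exact ContDiff.iterate_deriv' 2 2 (contDiff_infty.1 hW 4)
  have hpot : ContDiff ℝ 2 (fun r => ((iteratedDeriv 2 W (u0 r) : ℝ) : ℂ)) :=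
    Complex.ofRealCLM.contDiff.comp (hddW.comp (contDiff_infty.1 hu0 2))
  exact (hddu.sub (hpot.mul hu2)).add (contDiff_const.mul hu2)

/-- The eigenvalue system is equivalent to the scalar fourth-order equation for `U1`, with the
other components determined by `U1`. -/
theorem eigSystem_iff (W u0 : ℝ → ℝ) {lam0 : ℝ} (hlam0 : lam0 ≠ 0) (lam : ℂ)
    (U1 U2 U3 U4 : ℝ → ℂ) :
    EigSystem W u0 lam0 lam U1 U2 U3 U4 ↔
      ((∀ r, U2 r = lam * U1 r) ∧
       (∀ r, U3 r = L0c W u0 U1 r + (lam0 : ℂ) * lam ^ 2 * U1 r) ∧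
       (∀ r, U4 r = lam * (L0c W u0 U1 r + (lam0 : ℂ) * lam ^ 2 * U1 r)) ∧
       (∀ r, L0c W u0 (fun s => L0c W u0 U1 s + (lam0 : ℂ) * lam ^ 2 * U1 s) r
          + (lam0 : ℂ) * lam ^ 2 *
            (L0c W u0 U1 r + (lam0 : ℂ) * lam ^ 2 * U1 r) = 0)) := by
  have h0 : (lam0 : ℂ) ≠ 0 := by exact_mod_cast hlam0
  constructor
  · rintro ⟨h1, h2, h3, h4⟩
    have hU3 : ∀ r, U3 r = L0c W u0 U1 r + (lam0 : ℂ) * lam ^ 2 * U1 r := by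
      intro r
      have h := h2 r
      rw [← h1 r] at h
      field_simp at h
      linear_combination -h
    refine ⟨fun r => (h1 r).symm, hU3, fun r => by rw [← h3 r, hU3 r], fun r => ?_⟩
    have h := h4 r
    rw [← h3 r] at h
    field_simp at h
    rw [← funext hU3, ← hU3 r]
    linear_combination h
  · rintro ⟨h1, h2, h3, h4⟩
    refine ⟨fun r => (h1 r).symm, fun r => ?_, fun r => by rw [h2 r, h3 r], fun r => ?_⟩
    · rw [h1 r, h2 r]
      field_simp
      ring
    · have h := h4 r
      rw [← funext h2] at h
      rw [← h2 r] at h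
      rw [h3 r, ← h2 r]
      field_simp
      linear_combination h

/-- **Kernel of `𝕃_* − λ` and the scalar operator `(L0 + lam0 λ²)²`.** The eigenvalue
system for `𝕃_* − λ` holds iff `U2 = λU1`, `U3 = (L0 + lam0λ²)U1`, `U4 = λ(L0 + lam0λ²)U1`
and `(L0 + lam0λ²)² U1 = 0`; consequently the projection `(U1,U2,U3,U4) ↦ U1` is a (linear)
bijection from the kernel of `𝕃_* − λ` onto the kernel of `(L0 + lam0λ²)²`. -/
theorem eig_system_iff_scalar_kernel
    (W : ℝ → ℝ) (hW : ContDiff ℝ (⊤ : ℕ∞) W) (u0 : ℝ → ℝ) (hu0 : ContDiff ℝ (⊤ : ℕ∞) u0)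
    (lam0 : ℝ) (hlam0 : 0 < lam0) (lam : ℂ) :
    (∀ U1 U2 U3 U4 : ℝ → ℂ, ContDiff ℝ 4 U1 → ContDiff ℝ 2 U3 →
      (EigSystem W u0 lam0 lam U1 U2 U3 U4 ↔
        ((∀ r, U2 r = lam * U1 r) ∧
         (∀ r, U3 r = L0c W u0 U1 r + (lam0 : ℂ) * lam ^ 2 * U1 r) ∧
         (∀ r, U4 r = lam * (L0c W u0 U1 r + (lam0 : ℂ) * lam ^ 2 * U1 r)) ∧
         (∀ r, L0c W u0 (fun s => L0c W u0 U1 s + (lam0 : ℂ) * lam ^ 2 * U1 s) r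
            + (lam0 : ℂ) * lam ^ 2 *
              (L0c W u0 U1 r + (lam0 : ℂ) * lam ^ 2 * U1 r) = 0)))) ∧
    Set.BijOn (fun U : (ℝ → ℂ) × (ℝ → ℂ) × (ℝ → ℂ) × (ℝ → ℂ) => U.1)
      {U | ContDiff ℝ 4 U.1 ∧ ContDiff ℝ 2 U.2.2.1 ∧
        EigSystem W u0 lam0 lam U.1 U.2.1 U.2.2.1 U.2.2.2}
      {u : ℝ → ℂ | ContDiff ℝ 4 u ∧
        ∀ r, L0c W u0 (fun s => L0c W u0 u s + (lam0 : ℂ) * lam ^ 2 * u s) r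
          + (lam0 : ℂ) * lam ^ 2 * (L0c W u0 u r + (lam0 : ℂ) * lam ^ 2 * u r) = 0} := by
  have h0 : lam0 ≠ 0 := hlam0.ne'
  refine ⟨fun U1 U2 U3 U4 _ _ => eigSystem_iff W u0 h0 lam U1 U2 U3 U4, ?_, ?_, ?_⟩
  · rintro ⟨U1, U2, U3, U4⟩ ⟨hU1, -, hE⟩
    exact ⟨hU1, ((eigSystem_iff W u0 h0 lam U1 U2 U3 U4).1 hE).2.2.2⟩
  · rintro ⟨U1, U2, U3, U4⟩ ⟨-, -, hU⟩ ⟨V1, V2, V3, V4⟩ ⟨-, -, hV⟩ hUV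
    obtain rfl : U1 = V1 := hUV
    obtain ⟨hU2, hU3, hU4, -⟩ := (eigSystem_iff W u0 h0 lam U1 U2 U3 U4).1 hU
    obtain ⟨hV2, hV3, hV4, -⟩ := (eigSystem_iff W u0 h0 lam U1 V2 V3 V4).1 hV
    rw [funext hU2, funext hU3, funext hU4, funext hV2, funext hV3, funext hV4]
  · rintro u ⟨hu, hker⟩
    refine ⟨(u, fun r => lam * u r, fun r => L0c W u0 u r + (lam0 : ℂ) * lam ^ 2 * u r,
      fun r => lam * (L0c W u0 u r + (lam0 : ℂ) * lam ^ 2 * u r)),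
      ⟨hu, ContDiff.L0c_add_const_mul hW hu0 _ hu, ?_⟩, rfl⟩
    exact (eigSystem_iff W u0 h0 lam _ _ _ _).2
      ⟨fun _ => rfl, fun _ => rfl, fun _ => rfl, hker⟩
end
end

section
/- Let ε > 0 and κ ∈ ℝ \ {0} satisfy α0 − 2 α2 √ε κ > 0. Set r1 := (α0 − 2 α2 √ε κ)^{−1/4}, r2 := 1/r1, and ω := 1 + ω1 ε + sgn(κ) √ε r2² + α7 ε |κ| r1² + 2 α8 ε^{3/2} κ. Then for every θ ∈ ℝ the pair C1(t) = √(ε|κ|) r1 e^{i(ω t + θ)}, C2(t) = sgn(κ) i ε √|κ| r2 e^{i(ω t + θ)} is a solution of the PNF system; when ω ≠ 0 it is periodic with period 2π/ω, and its first integral K := (i/2)(C1 conj(C2) − conj(C1) C2) equals ε^{3/2} κ. -/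
noncomputable section

/-- The pearling normal form (PNF) system: `(C1, C2) : ℝ → ℂ²` is a (globally defined,
differentiable) solution of
`C1' = i(1+ω1 ε)C1 + C2 + i C1[α7 C1 C̄1 + α8 i (C1 C̄2 − C̄1 C2)]`,
`C2' = i(1+ω1 ε)C2 + i C2[α7 C1 C̄1 + α8 i (C1 C̄2 − C̄1 C2)] + C1[−α0 ε + i α2 (C1 C̄2 − C̄1 C2)]`. -/
def IsPNFSolution (ε ω1 α0 α2 α7 α8 : ℝ) (C1 C2 : ℝ → ℂ) : Prop :=
  Differentiable ℝ C1 ∧ Differentiable ℝ C2 ∧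
  (∀ t, deriv C1 t =
      Complex.I * ((1 + ω1 * ε : ℝ) : ℂ) * C1 t + C2 t +
        Complex.I * C1 t *
          ((α7 : ℂ) * C1 t * (starRingEnd ℂ) (C1 t) +
            (α8 : ℂ) * Complex.I *
              (C1 t * (starRingEnd ℂ) (C2 t) - (starRingEnd ℂ) (C1 t) * C2 t))) ∧
  (∀ t, deriv C2 t =
      Complex.I * ((1 + ω1 * ε : ℝ) : ℂ) * C2 t +
        Complex.I * C2 t *
          ((α7 : ℂ) * C1 t * (starRingEnd ℂ) (C1 t) +
            (α8 : ℂ) * Complex.I *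
              (C1 t * (starRingEnd ℂ) (C2 t) - (starRingEnd ℂ) (C1 t) * C2 t)) +
        C1 t * (-((α0 * ε : ℝ) : ℂ) +
          Complex.I * (α2 : ℂ) *
            (C1 t * (starRingEnd ℂ) (C2 t) - (starRingEnd ℂ) (C1 t) * C2 t)))

/-- Complex exponentials of imaginary numbers have modulus one. -/
theorem exp_I_mul_ofReal_mul_conj (x : ℝ) :
    Complex.exp (Complex.I * (x : ℂ)) * (starRingEnd ℂ) (Complex.exp (Complex.I * (x : ℂ))) = 1 := by
  rw [← Complex.exp_conj, ← Complex.exp_add]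
  simp

theorem exp_I_mul_add_period {ω : ℝ} (hω : ω ≠ 0) (θ t : ℝ) :
    Complex.exp (Complex.I * ((ω * (t + 2 * Real.pi / ω) + θ : ℝ) : ℂ)) =
      Complex.exp (Complex.I * ((ω * t + θ : ℝ) : ℂ)) := by
  have h : ω * (t + 2 * Real.pi / ω) + θ = ω * t + θ + 2 * Real.pi := by
    field_simp
    ring
  rw [h, Complex.exp_eq_exp_iff_exists_int]
  exact ⟨1, by push_cast; ring⟩

/-- A relative equilibrium ansatz `C1 = a e^{iφ}`, `C2 = i p e^{iφ}`, `φ = ω t + θ`, solves the PNF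
system as soon as its real amplitudes satisfy two algebraic equations. -/
theorem isPNFSolution_of_amplitudes (ε ω1 α0 α2 α7 α8 ω θ a p : ℝ)
    (h1 : ω * a = (1 + ω1 * ε) * a + p + a * (α7 * a ^ 2 + 2 * α8 * (a * p)))
    (h2 : ω * p = (1 + ω1 * ε) * p + p * (α7 * a ^ 2 + 2 * α8 * (a * p)) +
      a * (α0 * ε - 2 * α2 * (a * p))) :
    IsPNFSolution ε ω1 α0 α2 α7 α8
      (fun t => (a : ℂ) * Complex.exp (Complex.I * ((ω * t + θ : ℝ) : ℂ)))
      (fun t => Complex.I * (p : ℂ) * Complex.exp (Complex.I * ((ω * t + θ : ℝ) : ℂ))) := by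
  have hE (t : ℝ) : HasDerivAt (fun t : ℝ => Complex.exp (Complex.I * ((ω * t + θ : ℝ) : ℂ)))
      (Complex.exp (Complex.I * ((ω * t + θ : ℝ) : ℂ)) * (Complex.I * (ω : ℂ))) t := by
    have hφ : HasDerivAt (fun t : ℝ => ω * t + θ) ω t := by
      simpa using ((hasDerivAt_id t).const_mul ω).add_const θ
    exact (hφ.ofReal_comp.const_mul Complex.I).cexp
  have hc1 : (ω * a : ℂ) = (1 + ω1 * ε) * a + p + a * (α7 * a ^ 2 + 2 * α8 * (a * p)) := by
    exact_mod_cast h1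
  have hc2 : (ω * p : ℂ) = (1 + ω1 * ε) * p + p * (α7 * a ^ 2 + 2 * α8 * (a * p)) +
      a * (α0 * ε - 2 * α2 * (a * p)) := by
    exact_mod_cast h2
  refine ⟨fun t => ((hE t).const_mul _).differentiableAt,
    fun t => ((hE t).const_mul _).differentiableAt, fun t => ?_, fun t => ?_⟩
  all_goals
    rw [((hE t).const_mul _).deriv]
    have hn := exp_I_mul_ofReal_mul_conj (ω * t + θ)
    have hI : Complex.I ^ 2 = -1 := Complex.I_sq
    beta_reduce
    generalize Complex.exp (Complex.I * ((ω * t + θ : ℝ) : ℂ)) = E at hn ⊢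
    simp only [map_mul, Complex.conj_ofReal, Complex.conj_I]
    push_cast
    set i := Complex.I
  · linear_combination (i * E) * hc1 - (i * a * E) * (α7 * a ^ 2 - 2 * α8 * i ^ 2 * a * p) * hn +
      (2 * α8 * i * a ^ 2 * p * E) * hI
  · linear_combination (i ^ 2 * E) * hc2 -
      (i ^ 2 * p * E * (α7 * a ^ 2 - 2 * α8 * i ^ 2 * a * p) - 2 * α2 * i ^ 2 * a ^ 2 * p * E) * hn +
      (2 * α8 * i ^ 2 * a * p ^ 2 * E + α0 * ε * a * E) * hI

/-- **Explicit periodic orbits of the PNF system.** For `ε > 0`, `κ ≠ 0` with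
`α0 − 2α2√ε κ > 0`, and `r1 = (α0 − 2α2√ε κ)^{−1/4}`, `r2 = 1/r1`,
`ω = 1 + ω1 ε + sgn(κ)√ε r2² + α7 ε|κ| r1² + 2α8 ε^{3/2} κ`, the pair
`C1(t) = √(ε|κ|) r1 e^{i(ωt+θ)}`, `C2(t) = sgn(κ) i ε √|κ| r2 e^{i(ωt+θ)}` solves the PNF
system for every `θ`; when `ω ≠ 0` it has period `2π/ω`, and its first integral `K`
equals `ε^{3/2} κ`. -/
theorem pnf_explicit_periodic_orbit (ε ω1 α0 α2 α7 α8 κ θ : ℝ)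
    (hε : 0 < ε) (hκ : κ ≠ 0)
    (hpos : 0 < α0 - 2 * α2 * Real.sqrt ε * κ) :
    let r1 : ℝ := (α0 - 2 * α2 * Real.sqrt ε * κ) ^ (-(1:ℝ)/4)
    let r2 : ℝ := 1 / r1
    let ω : ℝ := 1 + ω1 * ε + Real.sign κ * Real.sqrt ε * r2 ^ 2
        + α7 * ε * |κ| * r1 ^ 2 + 2 * α8 * ε ^ ((3:ℝ)/2) * κ
    let C1 : ℝ → ℂ := fun t =>
      ((Real.sqrt (ε * |κ|) * r1 : ℝ) : ℂ) * Complex.exp (Complex.I * ((ω * t + θ : ℝ) : ℂ))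
    let C2 : ℝ → ℂ := fun t =>
      ((Real.sign κ : ℝ) : ℂ) * Complex.I * ((ε * Real.sqrt |κ| * r2 : ℝ) : ℂ) *
        Complex.exp (Complex.I * ((ω * t + θ : ℝ) : ℂ))
    IsPNFSolution ε ω1 α0 α2 α7 α8 C1 C2 ∧
    (ω ≠ 0 → ∀ t, C1 (t + 2 * Real.pi / ω) = C1 t ∧ C2 (t + 2 * Real.pi / ω) = C2 t) ∧
    (∀ t, Complex.I / 2 *
        (C1 t * (starRingEnd ℂ) (C2 t) - (starRingEnd ℂ) (C1 t) * C2 t)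
      = ((ε ^ ((3:ℝ)/2) * κ : ℝ) : ℂ)) := by
  intro r1 r2 ω C1 C2
  have hr1 : 0 < r1 := Real.rpow_pos_of_pos hpos _
  have hr12 : r1 * r2 = 1 := mul_one_div_cancel hr1.ne'
  have hr1_pow : r1 ^ 4 * (α0 - 2 * α2 * √ε * κ) = 1 := by
    have h : r1 ^ 4 = (α0 - 2 * α2 * √ε * κ)⁻¹ := by
      rw [← Real.rpow_natCast, ← Real.rpow_mul hpos.le, ← Real.rpow_neg_one]
      norm_num
    rw [h, inv_mul_cancel₀ hpos.ne']
  have hr2_pow : r2 ^ 4 = α0 - 2 * α2 * √ε * κ := by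
    linear_combination (-r2 ^ 4) * hr1_pow + (α0 - 2 * α2 * √ε * κ) *
      (r1 * r2 + 1) * ((r1 * r2) ^ 2 + 1) * hr12
  have hε32 : ε ^ ((3 : ℝ) / 2) = ε * √ε := by
    rw [Real.sqrt_eq_rpow, ← Real.rpow_one_add' hε.le (by norm_num)]
    norm_num
  have hsqrt : √(ε * |κ|) = √ε * √|κ| := Real.sqrt_mul hε.le _
  have hsε : √ε ^ 2 = ε := Real.sq_sqrt hε.le
  have hsκ : √|κ| ^ 2 = |κ| := Real.sq_sqrt (abs_nonneg κ)
  have hsign : Real.sign κ * |κ| = κ := by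
    rcases hκ.lt_or_gt with h | h
    · rw [Real.sign_of_neg h, abs_of_neg h]; ring
    · rw [Real.sign_of_pos h, abs_of_pos h]; ring
  have hsign_sq : Real.sign κ ^ 2 = 1 := by
    rcases Real.sign_apply_eq_of_ne_zero κ hκ with h | h <;> rw [h] <;> norm_num
  have hω : ω = 1 + ω1 * ε + Real.sign κ * √ε * r2 ^ 2 + α7 * ε * |κ| * r1 ^ 2 +
      2 * α8 * (ε * √ε) * κ := by
    rw [← hε32]
  obtain ⟨a, ha⟩ : ∃ a, a = √(ε * |κ|) * r1 := ⟨_, rfl⟩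
  obtain ⟨p, hp⟩ : ∃ p, p = Real.sign κ * (ε * √|κ| * r2) := ⟨_, rfl⟩
  have hC1 : C1 = fun t => (a : ℂ) * Complex.exp (Complex.I * ((ω * t + θ : ℝ) : ℂ)) := by
    rw [ha]
  have hC2 : C2 = fun t =>
      Complex.I * (p : ℂ) * Complex.exp (Complex.I * ((ω * t + θ : ℝ) : ℂ)) := by
    funext t
    simp only [C2, hp]
    push_cast
    ring
  have hap : a * p = ε * √ε * κ := by
    rw [ha, hp, hsqrt]
    linear_combination (ε * √ε * Real.sign κ * √|κ| ^ 2) * hr12 +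
      (ε * √ε * Real.sign κ) * hsκ + (ε * √ε) * hsign
  have ha_sq : a ^ 2 = ε * |κ| * r1 ^ 2 := by
    rw [ha, mul_pow, Real.sq_sqrt (by positivity)]
  have hp_eq : p = Real.sign κ * √ε * r2 ^ 2 * a := by
    rw [ha, hp, hsqrt]
    linear_combination (-(Real.sign κ * √|κ| * r2)) * hsε -
      (Real.sign κ * √ε ^ 2 * √|κ| * r2) * hr12
  have ha_eq : Real.sign κ * √ε * r2 ^ 2 * p = a * (α0 * ε - 2 * α2 * (a * p)) := by
    rw [hap]
    nth_rewrite 1 [hp_eq]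
    linear_combination (√ε ^ 2 * r2 ^ 4 * a) * hsign_sq + (r2 ^ 4 * a) * hsε + (ε * a) * hr2_pow
  clear_value ω C1 C2
  subst hC1 hC2
  refine ⟨isPNFSolution_of_amplitudes _ _ _ _ _ _ _ _ _ _ ?_ ?_, fun hω0 t => ?_, fun t => ?_⟩
  · rw [hap, ha_sq, hω]
    linear_combination -hp_eq
  · rw [← ha_eq, hap, ha_sq, hω]
    ring
  · simp only [exp_I_mul_add_period hω0, and_self]
  · have hn := exp_I_mul_ofReal_mul_conj (ω * t + θ)
    have hapc : (a * p : ℂ) = ε * √ε * κ := by exact_mod_cast hap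
    rw [hε32]
    simp only [map_mul, Complex.conj_ofReal, Complex.conj_I]
    push_cast at hn ⊢
    linear_combination (-Complex.I ^ 2 * a * p) * hn - (a * p : ℂ) * Complex.I_sq + hapc
end
end

section
/- Let (C1, C2) : ℝ → ℂ² be a solution of the PNF system. Then: (i) for every θ ∈ ℝ, the pair (e^{iθ} C1, e^{iθ} C2) is also a solution of the PNF system (rotational equivariance); and (ii) the map t ↦ (conj(C1(−t)), −conj(C2(−t))) is also a solution of the PNF system (reversibility with respect to the involution S1(C1, C2) = (conj(C1), −conj(C2))). -/
noncomputable section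

/-- The derivative of `s ↦ conj (f (-s))` at `t` is `-conj (deriv f (-t))`. -/
lemma hasDerivAt_conj_comp_neg {f : ℝ → ℂ} (hf : Differentiable ℝ f) (t : ℝ) :
    HasDerivAt (fun s => (starRingEnd ℂ) (f (-s))) (-(starRingEnd ℂ) (deriv f (-t))) t := by
  have h := ((hf (-t)).hasDerivAt.scomp t (hasDerivAt_neg t)).star
  simpa using h

/-- **Symmetries of the PNF system.** If `(C1, C2)` solves the PNF system then (i) for
every `θ ∈ ℝ` the rotated pair `(e^{iθ}C1, e^{iθ}C2)` is also a solution (rotational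
equivariance), and (ii) `t ↦ (conj(C1(−t)), −conj(C2(−t)))` is also a solution
(reversibility with respect to `S1(C1, C2) = (conj C1, −conj C2)`). -/
theorem pnf_symmetries (ε ω1 α0 α2 α7 α8 : ℝ) (C1 C2 : ℝ → ℂ)
    (hsol : IsPNFSolution ε ω1 α0 α2 α7 α8 C1 C2) :
    (∀ θ : ℝ, IsPNFSolution ε ω1 α0 α2 α7 α8
        (fun t => Complex.exp (Complex.I * (θ : ℂ)) * C1 t)
        (fun t => Complex.exp (Complex.I * (θ : ℂ)) * C2 t)) ∧
    IsPNFSolution ε ω1 α0 α2 α7 α8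
        (fun t => (starRingEnd ℂ) (C1 (-t)))
        (fun t => -(starRingEnd ℂ) (C2 (-t))) := by
  obtain ⟨hd1, hd2, h1, h2⟩ := hsol
  have hr1 := hasDerivAt_conj_comp_neg hd1
  have hr2 := fun t => (hasDerivAt_conj_comp_neg hd2 t).fun_neg
  refine ⟨fun θ => ⟨hd1.const_mul _, hd2.const_mul _, fun t => ?_, fun t => ?_⟩,
    fun t => (hr1 t).differentiableAt, fun t => (hr2 t).differentiableAt,
    fun t => ?_, fun t => ?_⟩
  rotate_left 2
  · rw [(hr1 t).deriv, h1]
    simp only [map_add, map_sub, map_mul, map_neg, Complex.conj_I, Complex.conj_ofReal,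
      Complex.conj_conj]
    ring
  · rw [(hr2 t).deriv, h2]
    simp only [map_add, map_sub, map_mul, map_neg, Complex.conj_I, Complex.conj_ofReal,
      Complex.conj_conj]
    ring
  all_goals
    have hE : Complex.exp (Complex.I * (θ : ℂ)) *
        (starRingEnd ℂ) (Complex.exp (Complex.I * (θ : ℂ))) = 1 := by
      rw [← Complex.exp_conj, ← Complex.exp_add]
      simp
    generalize Complex.exp (Complex.I * (θ : ℂ)) = E at hE ⊢
    simp only [map_mul]
  · rw [deriv_const_mul _ (hd1 t), h1]
    linear_combination (-(Complex.I * E * C1 t *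
      (α7 * C1 t * (starRingEnd ℂ) (C1 t) + α8 * Complex.I *
        (C1 t * (starRingEnd ℂ) (C2 t) - (starRingEnd ℂ) (C1 t) * C2 t)))) * hE
  · rw [deriv_const_mul _ (hd2 t), h2]
    linear_combination (-(Complex.I * E * C2 t *
      (α7 * C1 t * (starRingEnd ℂ) (C1 t) + α8 * Complex.I *
        (C1 t * (starRingEnd ℂ) (C2 t) - (starRingEnd ℂ) (C1 t) * C2 t)) +
      E * C1 t * (Complex.I * α2 *
        (C1 t * (starRingEnd ℂ) (C2 t) - (starRingEnd ℂ) (C1 t) * C2 t)))) * hE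
end
end

section
/- Consider the truncated normal form system Ċ = ℒ(ε)C + 𝓡₃(C) on points (C1, C2, C̄1, C̄2, D1, D2, D3, D4) with C̄j = conj(Cj) and Dj ∈ ℝ. Then: (i) the vector field is equivariant under the rotations R_θ(C1, C2, C̄1, C̄2, D1, D2, D3, D4) = (e^{iθ}C1, e^{iθ}C2, e^{−iθ}C̄1, e^{−iθ}C̄2, D1, D2, D3, D4) for every θ ∈ ℝ, i.e. if C(t) is a solution so is R_θ C(t); and (ii) the pearling subspace {D1 = D2 = D3 = D4 = 0} is invariant under the flow, and on it (C1, C2) satisfies the 1:1 resonant normal form C1' = i(1+ω1ε)C1 + C2 + iC1[α7 C1C̄1 + α8 i(C1C̄2 − C̄1C2)], C2' = i(1+ω1ε)C2 + iC2[α7 C1C̄1 + α8 i(C1C̄2 − C̄1C2)] + C1[ω2 ε + α1 C1C̄1 + i α2 (C1C̄2 − C̄1C2)]. -/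
noncomputable section

/-- A solution of the cubic-truncated normal form system
`Ċ = ℒ(ε)C + 𝓡₃(C)` on `(C1, C2, C̄1, C̄2, D1, D2, D3, D4)` (the conjugate components
being determined by `C1, C2`, and `D1,…,D4` real); the right-hand sides are the linear
part `ℒ(ε)` plus the cubic normal-form terms `𝓡_{3,1}`, `𝓡_{3,2}`, `𝓡_{3,8}`. -/
def IsTruncatedNFSolution (ε ω1 ω2 ω3 ω4 : ℝ)
    (α1 α2 α3 α4 α5 α6 α7 α8 α9 α10 α11 α12 : ℝ)
    (β1 β2 β3 β4 β5 β6 β7 β8 β9 β10 β11 β12 β13 : ℝ)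
    (C1 C2 : ℝ → ℂ) (D1 D2 D3 D4 : ℝ → ℝ) : Prop :=
  Differentiable ℝ C1 ∧ Differentiable ℝ C2 ∧
  Differentiable ℝ D1 ∧ Differentiable ℝ D2 ∧
  Differentiable ℝ D3 ∧ Differentiable ℝ D4 ∧
  (∀ t, deriv C1 t =
      Complex.I * ((1 + ω1 * ε : ℝ) : ℂ) * C1 t + C2 t +
      Complex.I *
        (C1 t * ((α7 : ℂ) * C1 t * (starRingEnd ℂ) (C1 t) +
            (α8 : ℂ) * Complex.I *
              (C1 t * (starRingEnd ℂ) (C2 t) - (starRingEnd ℂ) (C1 t) * C2 t)) +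
          (α9 : ℂ) * C1 t * ((D1 t : ℝ) : ℂ) ^ 2 +
          (α10 : ℂ) * Complex.I * ((D1 t : ℝ) : ℂ) *
            (C2 t * ((D1 t : ℝ) : ℂ) - C1 t * ((D2 t : ℝ) : ℂ)) +
          (α11 : ℂ) * C1 t * ((2 * D1 t * D3 t - D2 t ^ 2 : ℝ) : ℂ) +
          (α12 : ℂ) * Complex.I *
            (C1 t * ((D2 t * D3 t - 3 * D1 t * D4 t : ℝ) : ℂ) +
              C2 t * ((2 * D1 t * D3 t - D2 t ^ 2 : ℝ) : ℂ)))) ∧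
  (∀ t, deriv C2 t =
      ((ω2 * ε : ℝ) : ℂ) * C1 t + Complex.I * ((1 + ω1 * ε : ℝ) : ℂ) * C2 t +
      (C1 t * ((α1 : ℂ) * C1 t * (starRingEnd ℂ) (C1 t) +
            (α2 : ℂ) * Complex.I *
              (C1 t * (starRingEnd ℂ) (C2 t) - (starRingEnd ℂ) (C1 t) * C2 t)) +
          (α3 : ℂ) * C1 t * ((D1 t : ℝ) : ℂ) ^ 2 +
          (α4 : ℂ) * Complex.I * ((D1 t : ℝ) : ℂ) *
            (C2 t * ((D1 t : ℝ) : ℂ) - C1 t * ((D2 t : ℝ) : ℂ)) +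
          (α5 : ℂ) * C1 t * ((2 * D1 t * D3 t - D2 t ^ 2 : ℝ) : ℂ) +
          (α6 : ℂ) * Complex.I *
            (C1 t * ((D2 t * D3 t - 3 * D1 t * D4 t : ℝ) : ℂ) +
              C2 t * ((2 * D1 t * D3 t - D2 t ^ 2 : ℝ) : ℂ))) +
      Complex.I *
        (C2 t * ((α7 : ℂ) * C1 t * (starRingEnd ℂ) (C1 t) +
            (α8 : ℂ) * Complex.I *
              (C1 t * (starRingEnd ℂ) (C2 t) - (starRingEnd ℂ) (C1 t) * C2 t)) +
          (α9 : ℂ) * C2 t * ((D1 t : ℝ) : ℂ) ^ 2 +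
          (α10 : ℂ) * Complex.I * ((D2 t : ℝ) : ℂ) *
            (C2 t * ((D1 t : ℝ) : ℂ) - C1 t * ((D2 t : ℝ) : ℂ)) +
          (α11 : ℂ) * C1 t * ((3 * D1 t * D4 t - D2 t * D3 t : ℝ) : ℂ) +
          (α12 : ℂ) * Complex.I *
            (2 * C1 t * ((2 * D3 t ^ 2 - 3 * D2 t * D4 t : ℝ) : ℂ) +
              C2 t * ((3 * D1 t * D4 t - D2 t * D3 t : ℝ) : ℂ)))) ∧
  (∀ t, deriv D1 t = D2 t) ∧
  (∀ t, deriv D2 t = D3 t) ∧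
  (∀ t, deriv D3 t = D4 t) ∧
  (∀ t, deriv D4 t = ω3 * ε * D1 t + ω4 * ε * D3 t +
      (((D1 t : ℝ) : ℂ) *
          ((β1 : ℂ) * (C1 t * (starRingEnd ℂ) (C1 t)) +
            (β2 : ℂ) * (C2 t * (starRingEnd ℂ) (C2 t))) +
        Complex.I * (C1 t * (starRingEnd ℂ) (C2 t) - (starRingEnd ℂ) (C1 t) * C2 t) *
          ((β3 * D1 t + β4 * D3 t : ℝ) : ℂ) +
        (β5 : ℂ) * (C1 t * (starRingEnd ℂ) (C1 t)) * ((D3 t : ℝ) : ℂ) +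
        (β6 : ℂ) * ((D2 t : ℝ) : ℂ) *
          (C1 t * (starRingEnd ℂ) (C2 t) + (starRingEnd ℂ) (C1 t) * C2 t) +
        (β7 : ℂ) *
          (3 * (C1 t * (starRingEnd ℂ) (C2 t) + (starRingEnd ℂ) (C1 t) * C2 t) *
              ((D4 t : ℝ) : ℂ) -
            2 * (C2 t * (starRingEnd ℂ) (C2 t)) * ((D3 t : ℝ) : ℂ))).re +
      β8 * D1 t * D2 t ^ 2 + D1 t ^ 2 * (β9 * D1 t + β10 * D3 t) +
      β11 * (D2 t ^ 2 * D3 t - 2 * D1 t * D3 t ^ 2) +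
      β12 * (D2 t ^ 2 * D3 t - 3 * D1 t * D2 t * D4 t) +
      β13 * (9 * D2 t * D3 t * D4 t - 9 * D1 t * D4 t ^ 2 - 4 * D3 t ^ 3))

/-- A curve with `‖f'‖ ≤ k ‖f‖` for some continuous `k` that vanishes at one time vanishes at
all later times. -/
theorem eq_zero_of_norm_deriv_le_mul_norm_of_le {E : Type*} [NormedAddCommGroup E]
    [NormedSpace ℝ E] {f f' : ℝ → E} {k : ℝ → ℝ} (hk : Continuous k)
    (hf : ∀ t, HasDerivAt f (f' t) t) (hle : ∀ t, ‖f' t‖ ≤ k t * ‖f t‖)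
    {t₀ t : ℝ} (h₀ : f t₀ = 0) (ht : t₀ ≤ t) : f t = 0 := by
  obtain ⟨K, hK⟩ := (isCompact_Icc (a := t₀) (b := t)).bddAbove_image hk.continuousOn
  refine eq_zero_of_abs_deriv_le_mul_abs_self_of_eq_zero_right (K := K)
    (fun x _ => (hf x).continuousAt.continuousWithinAt) (fun x _ => (hf x).hasDerivWithinAt)
    h₀ (fun x hx => (hle x).trans ?_) t ⟨ht, le_rfl⟩
  gcongr
  exact hK ⟨x, Set.Ico_subset_Icc_self hx, rfl⟩

/-- A curve with `‖f'‖ ≤ k ‖f‖` for some continuous `k` that vanishes at one time vanishes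
identically. -/
theorem eq_zero_of_norm_deriv_le_mul_norm {E : Type*} [NormedAddCommGroup E]
    [NormedSpace ℝ E] {f f' : ℝ → E} {k : ℝ → ℝ} (hk : Continuous k)
    (hf : ∀ t, HasDerivAt f (f' t) t) (hle : ∀ t, ‖f' t‖ ≤ k t * ‖f t‖)
    {t₀ : ℝ} (h₀ : f t₀ = 0) (t : ℝ) : f t = 0 := by
  rcases le_total t₀ t with ht | ht
  · exact eq_zero_of_norm_deriv_le_mul_norm_of_le hk hf hle h₀ ht
  · have := eq_zero_of_norm_deriv_le_mul_norm_of_le (f := fun s => f (-s))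
      (f' := fun s => -f' (-s)) (k := fun s => k (-s)) (t₀ := -t₀) (t := -t)
      (hk.comp continuous_neg)
      (fun s => by simpa [Function.comp_def] using (hf (-s)).scomp s (hasDerivAt_neg s))
      (fun s => by simpa using hle (-s)) (by simpa using h₀) (neg_le_neg ht)
    simpa using this

/-- Uniqueness of the zero solution of a homogeneous linear fourth-order equation with continuous
coefficients, written as a first-order system. -/
theorem eq_zero_of_linear_fourth_order {a₁ a₂ a₃ a₄ x₁ x₂ x₃ x₄ : ℝ → ℝ}
    (ha₁ : Continuous a₁) (ha₂ : Continuous a₂) (ha₃ : Continuous a₃) (ha₄ : Continuous a₄)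
    (h₁ : ∀ t, HasDerivAt x₁ (x₂ t) t) (h₂ : ∀ t, HasDerivAt x₂ (x₃ t) t)
    (h₃ : ∀ t, HasDerivAt x₃ (x₄ t) t)
    (h₄ : ∀ t, HasDerivAt x₄ (a₁ t * x₁ t + a₂ t * x₂ t + a₃ t * x₃ t + a₄ t * x₄ t) t)
    {t₀ : ℝ} (h₀ : x₁ t₀ = 0 ∧ x₂ t₀ = 0 ∧ x₃ t₀ = 0 ∧ x₄ t₀ = 0) (t : ℝ) :
    x₁ t = 0 ∧ x₂ t = 0 ∧ x₃ t = 0 ∧ x₄ t = 0 := by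
  suffices h : (x₁ t, x₂ t, x₃ t, x₄ t) = 0 by simpa [Prod.ext_iff] using h
  refine eq_zero_of_norm_deriv_le_mul_norm (f := fun s => (x₁ s, x₂ s, x₃ s, x₄ s))
    (k := fun s => 1 + |a₁ s| + |a₂ s| + |a₃ s| + |a₄ s|) (by fun_prop)
    (fun s => (h₁ s).prodMk ((h₂ s).prodMk ((h₃ s).prodMk (h₄ s)))) (fun s => ?_)
    (t₀ := t₀) (by simpa [Prod.ext_iff] using h₀) t
  set N := ‖(x₁ s, x₂ s, x₃ s, x₄ s)‖ with hN
  have hN₀ : 0 ≤ N := norm_nonneg _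
  obtain ⟨b₁, b₂, b₃, b₄⟩ : |x₁ s| ≤ N ∧ |x₂ s| ≤ N ∧ |x₃ s| ≤ N ∧ |x₄ s| ≤ N := by
    simp [hN, Prod.norm_def]
  have hsum : |a₁ s * x₁ s + a₂ s * x₂ s + a₃ s * x₃ s + a₄ s * x₄ s|
      ≤ (|a₁ s| + |a₂ s| + |a₃ s| + |a₄ s|) * N :=
    calc |a₁ s * x₁ s + a₂ s * x₂ s + a₃ s * x₃ s + a₄ s * x₄ s|
        ≤ |a₁ s * x₁ s| + |a₂ s * x₂ s| + |a₃ s * x₃ s| + |a₄ s * x₄ s| :=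
          (abs_add_le _ _).trans
            (add_le_add_left ((abs_add_le _ _).trans (add_le_add_left (abs_add_le _ _) _)) _)
      _ ≤ |a₁ s| * N + |a₂ s| * N + |a₃ s| * N + |a₄ s| * N := by
          simp only [abs_mul]
          gcongr
      _ = _ := by ring
  have hA : 0 ≤ (|a₁ s| + |a₂ s| + |a₃ s| + |a₄ s|) * N := by positivity
  simp only [Prod.norm_def, Real.norm_eq_abs, sup_le_iff]
  refine ⟨?_, ?_, ?_, ?_⟩ <;> linarith

/-- **Rotational equivariance and invariance of the pearling subspace.** For any solution
of the truncated normal form system: (i) every rotation `R_θ` of the `C` components gives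
another solution; (ii) if the meander components `D1,…,D4` vanish at one time they vanish
identically, and in that case `(C1, C2)` satisfies the 1:1 resonant normal form. -/
theorem truncated_nf_equivariance_and_pearling_subspace
    (ε ω1 ω2 ω3 ω4 : ℝ)
    (α1 α2 α3 α4 α5 α6 α7 α8 α9 α10 α11 α12 : ℝ)
    (β1 β2 β3 β4 β5 β6 β7 β8 β9 β10 β11 β12 β13 : ℝ)
    (C1 C2 : ℝ → ℂ) (D1 D2 D3 D4 : ℝ → ℝ)
    (hsol : IsTruncatedNFSolution ε ω1 ω2 ω3 ω4
      α1 α2 α3 α4 α5 α6 α7 α8 α9 α10 α11 α12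
      β1 β2 β3 β4 β5 β6 β7 β8 β9 β10 β11 β12 β13 C1 C2 D1 D2 D3 D4) :
    (∀ θ : ℝ, IsTruncatedNFSolution ε ω1 ω2 ω3 ω4
      α1 α2 α3 α4 α5 α6 α7 α8 α9 α10 α11 α12
      β1 β2 β3 β4 β5 β6 β7 β8 β9 β10 β11 β12 β13
      (fun t => Complex.exp (Complex.I * (θ : ℂ)) * C1 t)
      (fun t => Complex.exp (Complex.I * (θ : ℂ)) * C2 t) D1 D2 D3 D4) ∧
    ((∃ t0, D1 t0 = 0 ∧ D2 t0 = 0 ∧ D3 t0 = 0 ∧ D4 t0 = 0) →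
      ∀ t, D1 t = 0 ∧ D2 t = 0 ∧ D3 t = 0 ∧ D4 t = 0) ∧
    ((∀ t, D1 t = 0 ∧ D2 t = 0 ∧ D3 t = 0 ∧ D4 t = 0) →
      (∀ t, deriv C1 t =
          Complex.I * ((1 + ω1 * ε : ℝ) : ℂ) * C1 t + C2 t +
            Complex.I * C1 t *
              ((α7 : ℂ) * C1 t * (starRingEnd ℂ) (C1 t) +
                (α8 : ℂ) * Complex.I *
                  (C1 t * (starRingEnd ℂ) (C2 t) - (starRingEnd ℂ) (C1 t) * C2 t))) ∧
      (∀ t, deriv C2 t =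
          Complex.I * ((1 + ω1 * ε : ℝ) : ℂ) * C2 t +
            Complex.I * C2 t *
              ((α7 : ℂ) * C1 t * (starRingEnd ℂ) (C1 t) +
                (α8 : ℂ) * Complex.I *
                  (C1 t * (starRingEnd ℂ) (C2 t) - (starRingEnd ℂ) (C1 t) * C2 t)) +
            C1 t * (((ω2 * ε : ℝ) : ℂ) + (α1 : ℂ) * C1 t * (starRingEnd ℂ) (C1 t) +
              Complex.I * (α2 : ℂ) *
                (C1 t * (starRingEnd ℂ) (C2 t) - (starRingEnd ℂ) (C1 t) * C2 t)))) := by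
  obtain ⟨hC1, hC2, hD1, hD2, hD3, hD4, eC1, eC2, eD1, eD2, eD3, eD4⟩ := hsol
  refine ⟨fun θ => ?_, ?_, fun hD => ⟨fun t => ?_, fun t => ?_⟩⟩
  · have hu : Complex.exp (Complex.I * θ) * (starRingEnd ℂ) (Complex.exp (Complex.I * θ)) = 1 := by
      simp [← Complex.exp_conj, ← Complex.exp_add]
    generalize Complex.exp (Complex.I * θ) = u at hu ⊢
    have hmul (a b : ℂ) : u * a * (starRingEnd ℂ) (u * b) = a * (starRingEnd ℂ) b := by
      rw [map_mul]
      linear_combination (a * (starRingEnd ℂ) b) * hu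
    have hmul' (a b : ℂ) : (starRingEnd ℂ) (u * a) * (u * b) = (starRingEnd ℂ) a * b := by
      rw [mul_comm, hmul, mul_comm]
    refine ⟨hC1.const_mul u, hC2.const_mul u, hD1, hD2, hD3, hD4, fun t => ?_, fun t => ?_,
      eD1, eD2, eD3, fun t => ?_⟩
    · rw [deriv_const_mul _ (hC1 t), eC1]
      simp only [hmul, hmul', mul_assoc (α7 : ℂ)]
      ring
    · rw [deriv_const_mul _ (hC2 t), eC2]
      simp only [hmul, hmul', mul_assoc (α7 : ℂ), mul_assoc (α1 : ℂ)]
      ring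
    · simp only [hmul, hmul']
      exact eD4 t
  · rintro ⟨t₀, h₀⟩
    have cC1 := hC1.continuous
    have cC2 := hC2.continuous
    have cD1 := hD1.continuous
    have cD2 := hD2.continuous
    have cD3 := hD3.continuous
    have cD4 := hD4.continuous
    refine eq_zero_of_linear_fourth_order
      (a₁ := fun t => ω3 * ε + β1 * Complex.normSq (C1 t) + β2 * Complex.normSq (C2 t)
        - 2 * β3 * (C1 t * (starRingEnd ℂ) (C2 t)).im + β8 * D2 t ^ 2
        + D1 t * (β9 * D1 t + β10 * D3 t) - 2 * β11 * D3 t ^ 2 - 9 * β13 * D4 t ^ 2)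
      (a₂ := fun t => 2 * β6 * (C1 t * (starRingEnd ℂ) (C2 t)).re + β11 * (D2 t * D3 t)
        + β12 * (D2 t * D3 t - 3 * D1 t * D4 t))
      (a₃ := fun t => ω4 * ε - 2 * β4 * (C1 t * (starRingEnd ℂ) (C2 t)).im
        + β5 * Complex.normSq (C1 t) - 2 * β7 * Complex.normSq (C2 t)
        + β13 * (9 * D2 t * D4 t - 4 * D3 t ^ 2))
      (a₄ := fun t => 6 * β7 * (C1 t * (starRingEnd ℂ) (C2 t)).re)
      ?_ ?_ ?_ ?_ (fun t => eD1 t ▸ (hD1 t).hasDerivAt) (fun t => eD2 t ▸ (hD2 t).hasDerivAt)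
      (fun t => eD3 t ▸ (hD3 t).hasDerivAt) (fun t => ?_) h₀
    · simp only [Complex.normSq_eq_norm_sq]; fun_prop
    · fun_prop
    · simp only [Complex.normSq_eq_norm_sq]; fun_prop
    · fun_prop
    · refine (hD4 t).hasDerivAt.congr_deriv ?_
      rw [eD4]
      simp [Complex.normSq_apply]
      ring
  · obtain ⟨d1, d2, d3, d4⟩ := hD t
    rw [eC1, d1, d2, d3, d4]
    push_cast
    ring
  · obtain ⟨d1, d2, d3, d4⟩ := hD t
    rw [eC2, d1, d2, d3, d4]
    push_cast
    ring
end
end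

section
/- Let μ1, μ2, μ3 ∈ ℝ. Then there exist ε0 > 0 and smooth functions ω̃1, ω̃2 : (−ε0, ε0) → ℝ with ω̃1(0) = ω̃2(0) = 0 such that for all ε ∈ (−ε0, ε0): (1 + ω̃1(ε))² − ω̃2(ε) = 1 + (μ1 − μ2 + μ3) ε and ((1 + ω̃1(ε))² + ω̃2(ε))² = 1 + 2(μ1 + μ2 + μ3) ε − 4(μ2 − μ3) μ1 ε²; moreover ω̃1(ε) = (1/2)(μ1 + μ3) ε + O(ε²) and ω̃2(ε) = μ2 ε + O(ε²) as ε → 0. -/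
open Asymptotics

/-- The first-order Taylor bound of the square root at `1`, valid on the whole real line. -/
theorem abs_sqrt_sub_one_sub_half_le (x : ℝ) :
    |√x - 1 - (x - 1) / 2| ≤ (x - 1) ^ 2 := by
  rcases le_total 0 x with hx | hx
  · obtain ⟨s, hs, rfl⟩ : ∃ s : ℝ, 0 ≤ s ∧ s ^ 2 = x := ⟨√x, Real.sqrt_nonneg x, Real.sq_sqrt hx⟩
    rw [Real.sqrt_sq hs, abs_le]
    have h : 0 ≤ (s - 1) ^ 2 * (s ^ 2 + 2 * s) := by positivity
    constructor <;> nlinarith [sq_nonneg (s - 1)]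
  · rw [Real.sqrt_eq_zero_of_nonpos hx, abs_le]
    constructor <;> nlinarith [sq_nonneg x]

/-- If `g ε = 1 + k ε + O(ε²)`, then `√(g ε) = 1 + (k / 2) ε + O(ε²)`. -/
theorem isBigO_sqrt_sub_one_sub_half_mul {g : ℝ → ℝ} {k : ℝ}
    (hg : (fun ε => g ε - 1 - k * ε) =O[nhds (0 : ℝ)] (fun ε => ε ^ 2)) :
    (fun ε => √(g ε) - 1 - k / 2 * ε) =O[nhds (0 : ℝ)] (fun ε => ε ^ 2) := by
  have hsq : (fun ε : ℝ => ε ^ 2) =O[nhds (0 : ℝ)] (fun ε => ε) :=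
    (isLittleO_pow_id one_lt_two).isBigO
  have hlin : (fun ε => g ε - 1) =O[nhds (0 : ℝ)] (fun ε => ε) :=
    ((hg.trans hsq).add ((isBigO_refl (fun ε : ℝ => ε) _).const_mul_left k)).congr_left
      fun ε => by ring
  have hrem : (fun ε => √(g ε) - 1 - (g ε - 1) / 2) =O[nhds (0 : ℝ)] (fun ε => ε ^ 2) := by
    refine (IsBigO.of_norm_le fun ε => ?_).trans (hlin.pow 2)
    exact abs_sqrt_sub_one_sub_half_le (g ε)
  exact (hrem.add (hg.const_mul_left (1 / 2))).congr_left fun ε => by ring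

/-- **Versal normal form coefficients.** For any `μ1, μ2, μ3 ∈ ℝ` there are smooth
functions `ω̃1, ω̃2` on a neighborhood `(−ε0, ε0)` of `0`, vanishing at `0`, solving the
system obtained by matching the characteristic polynomials of the pearling block of the
reduced linearization and of its versal deformation; moreover
`ω̃1(ε) = ½(μ1+μ3)ε + O(ε²)` and `ω̃2(ε) = μ2 ε + O(ε²)`. -/
theorem versal_deformation_coefficients (μ1 μ2 μ3 : ℝ) :
    ∃ ε0 > (0:ℝ), ∃ w1 w2 : ℝ → ℝ,
      ContDiffOn ℝ (⊤ : ℕ∞) w1 (Set.Ioo (-ε0) ε0) ∧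
      ContDiffOn ℝ (⊤ : ℕ∞) w2 (Set.Ioo (-ε0) ε0) ∧
      w1 0 = 0 ∧ w2 0 = 0 ∧
      (∀ ε ∈ Set.Ioo (-ε0) ε0,
        (1 + w1 ε) ^ 2 - w2 ε = 1 + (μ1 - μ2 + μ3) * ε ∧
        ((1 + w1 ε) ^ 2 + w2 ε) ^ 2
          = 1 + 2 * (μ1 + μ2 + μ3) * ε - 4 * (μ2 - μ3) * μ1 * ε ^ 2) ∧
      (fun ε => w1 ε - (1/2) * (μ1 + μ3) * ε) =O[nhds (0:ℝ)] (fun ε => ε ^ 2) ∧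
      (fun ε => w2 ε - μ2 * ε) =O[nhds (0:ℝ)] (fun ε => ε ^ 2) := by
  set a : ℝ := μ1 - μ2 + μ3 with ha
  set b : ℝ := μ1 + μ2 + μ3 with hb
  set c : ℝ := 4 * (μ2 - μ3) * μ1
  have hsmall : ∀ᶠ ε : ℝ in nhds 0, 0 < 1 + 2 * b * ε - c * ε ^ 2 ∧ 0 < 1 + a * ε := by
    have h₁ : ContinuousAt (fun ε : ℝ => 1 + 2 * b * ε - c * ε ^ 2) 0 := by fun_prop
    have h₂ : ContinuousAt (fun ε : ℝ => 1 + a * ε) 0 := by fun_prop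
    exact (h₁.eventually_const_lt (by simp)).and (h₂.eventually_const_lt (by simp))
  obtain ⟨ε0, hε0, hpos⟩ := Metric.eventually_nhds_iff_ball.mp hsmall
  rw [Real.ball_eq_Ioo, zero_sub, zero_add] at hpos
  have hdisc : ContDiffOn ℝ (⊤ : ℕ∞) (fun ε : ℝ => √(1 + 2 * b * ε - c * ε ^ 2))
      (Set.Ioo (-ε0) ε0) :=
    ContDiffOn.sqrt (by fun_prop) fun ε hε => (hpos ε hε).1.ne'
  have hmean : ∀ ε ∈ Set.Ioo (-ε0) ε0,
      0 < ((1 + a * ε) + √(1 + 2 * b * ε - c * ε ^ 2)) / 2 := fun ε hε => by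
    have := (hpos ε hε).2
    positivity
  have hdiscO : (fun ε : ℝ => √(1 + 2 * b * ε - c * ε ^ 2) - 1 - 2 * b / 2 * ε)
      =O[nhds (0 : ℝ)] (fun ε => ε ^ 2) :=
    isBigO_sqrt_sub_one_sub_half_mul <|
      ((isBigO_refl (fun ε : ℝ => ε ^ 2) _).const_mul_left (-c)).congr_left fun ε => by ring
  refine ⟨ε0, hε0, fun ε => √(((1 + a * ε) + √(1 + 2 * b * ε - c * ε ^ 2)) / 2) - 1,
    fun ε => (√(1 + 2 * b * ε - c * ε ^ 2) - (1 + a * ε)) / 2, ?_, ?_, ?_, ?_, ?_, ?_, ?_⟩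
  · refine ContDiffOn.sub (ContDiffOn.sqrt ?_ fun ε hε => (hmean ε hε).ne') contDiffOn_const
    exact ContDiffOn.div_const (ContDiffOn.add (by fun_prop) hdisc) 2
  · exact ContDiffOn.div_const (hdisc.sub (by fun_prop)) 2
  · norm_num
  · norm_num
  · intro ε hε
    have hs := Real.sq_sqrt (hpos ε hε).1.le
    have hm := Real.sq_sqrt (hmean ε hε).le
    simp only [add_sub_cancel, hm]
    constructor
    · ring
    · linear_combination hs
  · have hmeanO : (fun ε : ℝ => ((1 + a * ε) + √(1 + 2 * b * ε - c * ε ^ 2)) / 2 - 1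
        - (a + b) / 2 * ε) =O[nhds (0 : ℝ)] (fun ε => ε ^ 2) :=
      (hdiscO.const_mul_left (1 / 2)).congr_left fun ε => by ring
    refine (isBigO_sqrt_sub_one_sub_half_mul hmeanO).congr_left fun ε => ?_
    rw [ha, hb]
    ring
  · refine (hdiscO.const_mul_left (1 / 2)).congr_left fun ε => ?_
    linear_combination (ε / 2) * ha - (ε / 2) * hb
end

section
/- Let R = ℂ[C1, C2, C̄1, C̄2, D1, D2, D3, D4] be the polynomial ring in eight independent commuting variables, and let D^ad be the derivation D^ad = (−iC1)∂_{C1} + (C1 − iC2)∂_{C2} + (iC̄1)∂_{C̄1} + (C̄1 + iC̄2)∂_{C̄2} + D1∂_{D2} + D2∂_{D3} + D3∂_{D4}. Let P2 ⊂ R be the subspace of homogeneous polynomials of degree 2. Then the kernel of D^ad restricted to P2 is exactly the ℂ-linear span of {C1C̄1, C1C̄2 − C̄1C2, D1², 2D1D3 − D2²}, and the kernel of D^ad + i·id restricted to P2 is exactly the ℂ-linear span of {C1D1, C1D2 − C2D1}. -/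
noncomputable section

open MvPolynomial

/-- The adjoint homological operator
`D^ad = (−iC1)∂_{C1} + (C1 − iC2)∂_{C2} + (iC̄1)∂_{C̄1} + (C̄1 + iC̄2)∂_{C̄2}
      + D1∂_{D2} + D2∂_{D3} + D3∂_{D4}`
on the polynomial ring `ℂ[C1, C2, C̄1, C̄2, D1, D2, D3, D4]`, with the eight variables
indexed `0,…,7` as `C1, C2, C̄1, C̄2, D1, D2, D3, D4`. -/
def Dad (p : MvPolynomial (Fin 8) ℂ) : MvPolynomial (Fin 8) ℂ :=
  (-(C Complex.I) * X 0) * pderiv 0 p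
    + (X 0 - C Complex.I * X 1) * pderiv 1 p
    + (C Complex.I * X 2) * pderiv 2 p
    + (X 2 + C Complex.I * X 3) * pderiv 3 p
    + X 4 * pderiv 5 p
    + X 5 * pderiv 6 p
    + X 6 * pderiv 7 p

/-- The quadratic form with coefficient matrix `a`, as a polynomial. -/
def quadPoly {σ : Type*} [Fintype σ] (a : σ → σ → ℂ) : MvPolynomial σ ℂ :=
  ∑ i, ∑ k, C (a i k) * (X i * X k)

lemma pderiv_pderiv_comm {σ R : Type*} [CommSemiring R] (i j : σ) (p : MvPolynomial σ R) :
    pderiv i (pderiv j p) = pderiv j (pderiv i p) := by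
  classical
  induction p using MvPolynomial.induction_on with
  | C r => simp
  | add p q hp hq => simp [hp, hq]
  | mul_X p k hp =>
    simp only [pderiv_mul, map_add, hp, pderiv_X, Pi.single_apply, apply_ite (pderiv _), map_zero,
      pderiv_one, ite_self, mul_zero, add_zero]
    ring

lemma exists_symm_quadPoly {σ : Type*} [Fintype σ] {p : MvPolynomial σ ℂ}
    (hp : p.IsHomogeneous 2) :
    ∃ a : σ → σ → ℂ, (∀ i k, a i k = a k i) ∧ p = quadPoly a := by
  refine ⟨fun i k => 1 / 2 * coeff 0 (pderiv k (pderiv i p)), fun i k => ?_, ?_⟩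
  · simp only [pderiv_pderiv_comm i k]
  · have h2 : ∀ i k, pderiv k (pderiv i p) = C (coeff 0 (pderiv k (pderiv i p))) := fun i k =>
      totalDegree_eq_zero_iff_eq_C.mp
        (Nat.le_zero.mp ((hp.pderiv (i := i)).pderiv (i := k)).totalDegree_le)
    have h1 : ∀ i, ∑ k, X k * pderiv k (pderiv i p) = pderiv i p := fun i => by
      simpa using (hp.pderiv (i := i)).sum_X_mul_pderiv
    have h0 : ∑ i, X i * pderiv i p = 2 * p := by simpa using hp.sum_X_mul_pderiv
    have h : quadPoly (fun i k => 1 / 2 * coeff 0 (pderiv k (pderiv i p))) =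
        C (1 / 2) * ∑ i, X i * pderiv i p := by
      rw [quadPoly, Finset.mul_sum]
      refine Finset.sum_congr rfl fun i _ => ?_
      rw [← h1 i, Finset.mul_sum, Finset.mul_sum]
      refine Finset.sum_congr rfl fun k _ => ?_
      rw [h1, h2 i k, C_mul, coeff_zero_C]
      ring
    rw [h, h0, ← mul_assoc, show (2 : MvPolynomial σ ℂ) = C 2 from rfl, ← C_mul]
    norm_num

lemma pderiv_quadPoly {σ : Type*} [Fintype σ] (a : σ → σ → ℂ) (j : σ) :
    pderiv j (quadPoly a) = ∑ k, C (a j k + a k j) * X k := by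
  classical
  simp only [quadPoly, map_sum, Derivation.leibniz, pderiv_X, pderiv_C, Pi.single_apply,
    smul_eq_mul, mul_ite, mul_one, mul_zero, add_zero, mul_add, Finset.sum_add_distrib,
    Finset.sum_ite_irrel, Finset.sum_const_zero, C_add, add_mul]
  simp only [Finset.sum_ite_eq', Finset.mem_univ, if_true]
  exact add_comm _ _

lemma add_swap_eq_zero_of_quadPoly_eq_zero {σ : Type*} [Fintype σ] {b : σ → σ → ℂ}
    (h : quadPoly b = 0) (r s : σ) : b r s + b s r = 0 := by
  classical
  have := congrArg (pderiv s) ((pderiv_quadPoly b r).symm.trans (by rw [h, map_zero]))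
  simpa [Derivation.leibniz, pderiv_X, Pi.single_apply, ← C_add, -map_add] using this

lemma quadPoly_eq_sum_mul {σ : Type*} [Fintype σ] (a : σ → σ → ℂ) :
    quadPoly a = ∑ i, X i * ∑ k, C (a i k) * X k := by
  simp only [quadPoly, Finset.mul_sum, mul_left_comm]

lemma Dad_quadPoly_add {a : Fin 8 → Fin 8 → ℂ} (hs : ∀ i k, a i k = a k i) (c : ℂ) :
    Dad (quadPoly a) + C c * quadPoly a = quadPoly fun i k =>
      2 * (![-Complex.I, -Complex.I, Complex.I, Complex.I, 0, 0, 0, 0] i * a i k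
        + ![1, 0, 1, 0, 1, 1, 1, 0] i * a (i + 1) k) + c * a i k := by
  have hd : ∀ j, pderiv j (quadPoly a) = 2 * ∑ k, C (a j k) * X k := fun j => by
    rw [pderiv_quadPoly, Finset.mul_sum]
    refine Finset.sum_congr rfl fun k _ => ?_
    rw [hs k j, C_add]
    ring
  have hr : ∀ d s : Fin 8 → ℂ, ∀ i, ∑ k, C (2 * (d i * a i k + s i * a (i + 1) k) + c * a i k)
      * (X k : MvPolynomial (Fin 8) ℂ) = (2 * C (d i) + C c) * ∑ k, C (a i k) * X k
        + 2 * C (s i) * ∑ k, C (a (i + 1) k) * X k := fun d s i => by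
    simp only [Finset.mul_sum, ← Finset.sum_add_distrib]
    refine Finset.sum_congr rfl fun k _ => ?_
    simp only [C_add, C_mul, show (C 2 : MvPolynomial (Fin 8) ℂ) = 2 from rfl]
    ring
  simp only [quadPoly_eq_sum_mul (fun i k => _ + c * a i k), hr, Dad, hd]
  rw [quadPoly_eq_sum_mul]
  obtain ⟨L, hL⟩ : ∃ L : Fin 8 → MvPolynomial (Fin 8) ℂ, ∀ j, ∑ k, C (a j k) * X k = L j :=
    ⟨_, fun _ => rfl⟩
  simp [hL, Fin.sum_univ_eight]
  ring

lemma coeff_equations_of_Dad_add_eq_zero {a : Fin 8 → Fin 8 → ℂ} (hs : ∀ i k, a i k = a k i) {c : ℂ}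
    (h : Dad (quadPoly a) + C c * quadPoly a = 0) (i k : Fin 8) :
    ![-Complex.I, -Complex.I, Complex.I, Complex.I, 0, 0, 0, 0] i * a i k
      + ![-Complex.I, -Complex.I, Complex.I, Complex.I, 0, 0, 0, 0] k * a i k
      + ![1, 0, 1, 0, 1, 1, 1, 0] i * a (i + 1) k
      + ![1, 0, 1, 0, 1, 1, 1, 0] k * a i (k + 1) + c * a i k = 0 := by
  have := add_swap_eq_zero_of_quadPoly_eq_zero ((Dad_quadPoly_add hs c).symm.trans h) i k
  simp only [hs k i, hs (k + 1) i] at this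
  linear_combination this / 2

lemma quadPoly_eq_of_Dad_eq_zero {a : Fin 8 → Fin 8 → ℂ} (hs : ∀ i k, a i k = a k i)
    (h : Dad (quadPoly a) = 0) : quadPoly a = (2 * a 0 2) • (X 0 * X 2) +
      (2 * a 0 3) • (X 0 * X 3 - X 2 * X 1) + a 4 4 • X 4 ^ 2 +
      a 4 6 • (2 * X 4 * X 6 - X 5 ^ 2) := by
  have e := coeff_equations_of_Dad_add_eq_zero hs (c := 0) (by rw [h]; simp)
  have hI := Complex.I_ne_zero
  simp [Fin.forall_fin_succ] at e hs
  have hz :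
      a 0 0 = 0 ∧ a 0 1 = 0 ∧ a 0 4 = 0 ∧ a 0 5 = 0 ∧ a 0 6 = 0 ∧ a 0 7 = 0 ∧ a 1 0 = 0 ∧
      a 1 1 = 0 ∧ a 1 3 = 0 ∧ a 1 4 = 0 ∧ a 1 5 = 0 ∧ a 1 6 = 0 ∧ a 1 7 = 0 ∧ a 2 2 = 0 ∧
      a 2 3 = 0 ∧ a 2 4 = 0 ∧ a 2 5 = 0 ∧ a 2 6 = 0 ∧ a 2 7 = 0 ∧ a 3 1 = 0 ∧ a 3 2 = 0 ∧
      a 3 3 = 0 ∧ a 3 4 = 0 ∧ a 3 5 = 0 ∧ a 3 6 = 0 ∧ a 3 7 = 0 ∧ a 4 0 = 0 ∧ a 4 1 = 0 ∧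
      a 4 2 = 0 ∧ a 4 3 = 0 ∧ a 4 5 = 0 ∧ a 4 7 = 0 ∧ a 5 0 = 0 ∧ a 5 1 = 0 ∧ a 5 2 = 0 ∧
      a 5 3 = 0 ∧ a 5 4 = 0 ∧ a 5 6 = 0 ∧ a 5 7 = 0 ∧ a 6 0 = 0 ∧ a 6 1 = 0 ∧ a 6 2 = 0 ∧
      a 6 3 = 0 ∧ a 6 5 = 0 ∧ a 6 6 = 0 ∧ a 6 7 = 0 ∧ a 7 0 = 0 ∧ a 7 1 = 0 ∧ a 7 2 = 0 ∧
      a 7 3 = 0 ∧ a 7 4 = 0 ∧ a 7 5 = 0 ∧ a 7 6 = 0 ∧ a 7 7 = 0 := by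
    grind
  have hr : a 1 2 = -a 0 3 ∧ a 2 1 = -a 0 3 ∧ a 3 0 = a 0 3 ∧ a 2 0 = a 0 2 ∧ a 6 4 = a 4 6 ∧
      a 5 5 = -a 4 6 := by
    grind
  simp only [quadPoly, Fin.sum_univ_eight, smul_eq_C_mul, hz, hr, C_0, C_neg, C_mul,
    show (C 2 : MvPolynomial (Fin 8) ℂ) = 2 from rfl]
  ring

lemma quadPoly_eq_of_Dad_add_I_eq_zero {a : Fin 8 → Fin 8 → ℂ} (hs : ∀ i k, a i k = a k i)
    (h : Dad (quadPoly a) + C Complex.I * quadPoly a = 0) :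
    quadPoly a = (2 * a 0 4) • (X 0 * X 4) + (2 * a 0 5) • (X 0 * X 5 - X 1 * X 4) := by
  have e := coeff_equations_of_Dad_add_eq_zero hs h
  have hI := Complex.I_ne_zero
  simp [Fin.forall_fin_succ] at e hs
  have hz :
      a 0 0 = 0 ∧ a 0 1 = 0 ∧ a 0 2 = 0 ∧ a 0 3 = 0 ∧ a 0 6 = 0 ∧ a 0 7 = 0 ∧ a 1 0 = 0 ∧
      a 1 1 = 0 ∧ a 1 2 = 0 ∧ a 1 3 = 0 ∧ a 1 5 = 0 ∧ a 1 6 = 0 ∧ a 1 7 = 0 ∧ a 2 0 = 0 ∧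
      a 2 1 = 0 ∧ a 2 2 = 0 ∧ a 2 3 = 0 ∧ a 2 4 = 0 ∧ a 2 5 = 0 ∧ a 2 6 = 0 ∧ a 2 7 = 0 ∧
      a 3 0 = 0 ∧ a 3 1 = 0 ∧ a 3 2 = 0 ∧ a 3 3 = 0 ∧ a 3 4 = 0 ∧ a 3 5 = 0 ∧ a 3 6 = 0 ∧
      a 3 7 = 0 ∧ a 4 2 = 0 ∧ a 4 3 = 0 ∧ a 4 4 = 0 ∧ a 4 5 = 0 ∧ a 4 6 = 0 ∧ a 4 7 = 0 ∧
      a 5 1 = 0 ∧ a 5 2 = 0 ∧ a 5 3 = 0 ∧ a 5 4 = 0 ∧ a 5 5 = 0 ∧ a 5 6 = 0 ∧ a 5 7 = 0 ∧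
      a 6 0 = 0 ∧ a 6 1 = 0 ∧ a 6 2 = 0 ∧ a 6 3 = 0 ∧ a 6 4 = 0 ∧ a 6 5 = 0 ∧ a 6 6 = 0 ∧
      a 6 7 = 0 ∧ a 7 0 = 0 ∧ a 7 1 = 0 ∧ a 7 2 = 0 ∧ a 7 3 = 0 ∧ a 7 4 = 0 ∧ a 7 5 = 0 ∧
      a 7 6 = 0 ∧ a 7 7 = 0 := by
    grind
  have hr : a 1 4 = -a 0 5 ∧ a 4 1 = -a 0 5 ∧ a 4 0 = a 0 4 ∧ a 5 0 = a 0 5 := by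
    grind
  simp only [quadPoly, Fin.sum_univ_eight, smul_eq_C_mul, hz, hr, C_0, C_neg, C_mul,
    show (C 2 : MvPolynomial (Fin 8) ℂ) = 2 from rfl]
  ring

lemma isHomogeneous_and_Dad_add_eq_zero_of_mem_span {S : Set (MvPolynomial (Fin 8) ℂ)} {c : ℂ}
    (hS : ∀ p ∈ S, p.IsHomogeneous 2 ∧ Dad p + C c * p = 0) {p : MvPolynomial (Fin 8) ℂ}
    (hp : p ∈ Submodule.span ℂ S) : p.IsHomogeneous 2 ∧ Dad p + C c * p = 0 := by
  induction hp using Submodule.span_induction with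
  | mem x hx => exact hS x hx
  | zero => exact ⟨isHomogeneous_zero .., by simp [Dad]⟩
  | add x y _ _ hx hy =>
    refine ⟨hx.1.add hy.1, ?_⟩
    have hxy : Dad (x + y) = Dad x + Dad y := by
      simp only [Dad, map_add]
      ring
    linear_combination hxy + hx.2 + hy.2
  | smul r x _ hx =>
    refine ⟨(homogeneousSubmodule _ _ _).smul_mem r hx.1, ?_⟩
    have hrx : Dad (r • x) = C r * Dad x := by
      simp only [Dad, smul_eq_C_mul, pderiv_C_mul]
      ring
    rw [hrx, smul_eq_C_mul]
    linear_combination C r * hx.2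

/-- **Quadratic kernels of the adjoint homological operator.** On homogeneous quadratic
polynomials, `ker D^ad = span{C1C̄1, C1C̄2 − C̄1C2, D1², 2D1D3 − D2²}` and
`ker(D^ad + i·id) = span{C1D1, C1D2 − C2D1}`. -/
theorem quadratic_kernels_of_Dad :
    {p : MvPolynomial (Fin 8) ℂ | p.IsHomogeneous 2 ∧ Dad p = 0}
      = ↑(Submodule.span ℂ
          ({X 0 * X 2, X 0 * X 3 - X 2 * X 1, X 4 ^ 2, 2 * X 4 * X 6 - X 5 ^ 2} :
            Set (MvPolynomial (Fin 8) ℂ))) ∧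
    {p : MvPolynomial (Fin 8) ℂ | p.IsHomogeneous 2 ∧ Dad p + C Complex.I * p = 0}
      = ↑(Submodule.span ℂ
          ({X 0 * X 4, X 0 * X 5 - X 1 * X 4} : Set (MvPolynomial (Fin 8) ℂ))) := by
  have hX : ∀ i j : Fin 8, (X i * X j : MvPolynomial (Fin 8) ℂ).IsHomogeneous 2 := fun i j =>
    (isHomogeneous_X _ i).mul (isHomogeneous_X _ j)
  refine ⟨Set.Subset.antisymm ?_ ?_, Set.Subset.antisymm ?_ ?_⟩
  · rintro p ⟨hp, h⟩
    obtain ⟨a, hs, rfl⟩ := exists_symm_quadPoly hp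
    rw [SetLike.mem_coe, quadPoly_eq_of_Dad_eq_zero hs h]
    refine add_mem (add_mem (add_mem ?_ ?_) ?_) ?_ <;>
      exact Submodule.smul_mem _ _ (Submodule.subset_span (by simp))
  · intro p hp
    have := isHomogeneous_and_Dad_add_eq_zero_of_mem_span (c := 0) ?_ hp
    · simpa using this
    rintro p (rfl | rfl | rfl | rfl)
    · exact ⟨hX 0 2, by simp [Dad, pderiv_X]; ring⟩
    · exact ⟨(hX 0 3).sub (hX 2 1), by simp [Dad, pderiv_X]; ring⟩
    · exact ⟨by simpa [sq] using hX 4 4, by simp [Dad, pderiv_X]⟩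
    · rw [mul_assoc, two_mul, sq]
      refine ⟨?_, by simp [Dad, pderiv_X]; ring⟩
      exact ((hX 4 6).add (hX 4 6)).sub (hX 5 5)
  · rintro p ⟨hp, h⟩
    obtain ⟨a, hs, rfl⟩ := exists_symm_quadPoly hp
    rw [SetLike.mem_coe, quadPoly_eq_of_Dad_add_I_eq_zero hs h]
    refine add_mem ?_ ?_ <;>
      exact Submodule.smul_mem _ _ (Submodule.subset_span (by simp))
  · intro p hp
    refine isHomogeneous_and_Dad_add_eq_zero_of_mem_span ?_ hp
    rintro p (rfl | rfl)
    · exact ⟨hX 0 4, by simp [Dad, pderiv_X]; ring⟩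
    · exact ⟨(hX 0 5).sub (hX 1 4), by simp [Dad, pderiv_X]; ring⟩
end
end

section
/- Fix γ, η1, η_d ∈ ℝ. There exist ε0 > 0 and smooth functions u₋, v₋ : (−ε0, ε0) → ℝ with u₋(0) = −1 and v₋(0) = −γ/μ₋ such that for every ε ∈ (−ε0, ε0) the point (u₋(ε), 0, v₋(ε), 0) is a critical point of the flat-bilayer ODE system, i.e. W'(u₋(ε)) + ε v₋(ε) = 0 and W''(u₋(ε)) v₋(ε) + γ − η_d W'(u₋(ε)) − ε η1 v₋(ε) = 0; moreover the far-field amphiphile density satisfies 1 + u₋(ε) = (γ/μ₋²) ε + O(ε²) as ε → 0. -/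
open Asymptotics

open Filter Topology in
/-- A function smooth near `a` with nonzero derivative at `a` has a local right inverse that is
smooth near its base point. -/
theorem exists_local_inverse_eventually_contDiffAt {g : ℝ → ℝ} {a g' : ℝ}
    (hg : ∀ᶠ x in 𝓝 a, ContDiffAt ℝ (⊤ : ℕ∞) g x) (hg' : HasDerivAt g g' a) (h0 : g' ≠ 0) :
    ∃ h : ℝ → ℝ, h (g a) = a ∧ HasDerivAt h g'⁻¹ (g a) ∧
      ∀ᶠ y in 𝓝 (g a), g (h y) = y ∧ ContDiffAt ℝ (⊤ : ℕ∞) h y := by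
  have hs : HasStrictDerivAt g g' a := hg.self_of_nhds.hasStrictDerivAt' hg' (by simp)
  have hsf := hs.hasStrictFDerivAt_equiv h0
  set e := hsf.toOpenPartialHomeomorph g
  have hga : g a ∈ e.target := hsf.image_mem_toOpenPartialHomeomorph_target
  have hinv : e.symm (g a) = a := e.left_inv hsf.mem_toOpenPartialHomeomorph_source
  have hcont : Tendsto e.symm (𝓝 (g a)) (𝓝 a) := by
    simpa only [ContinuousAt, hinv] using e.continuousAt_symm hga
  have hderiv : ∀ᶠ x in 𝓝 a, deriv g x ≠ 0 := by
    have hc : ContinuousAt (deriv g) a :=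
      (hg.self_of_nhds.derivWithin (m := 0) (by simp)).continuousAt
    exact hc.eventually_ne (by rwa [hg'.deriv])
  refine ⟨e.symm, hinv, (hs.to_localInverse h0).hasDerivAt, ?_⟩
  filter_upwards [e.open_target.mem_nhds hga, hcont.eventually hg, hcont.eventually hderiv]
    with y hy hgy hdy
  refine ⟨e.right_inv hy, e.contDiffAt_symm_deriv hdy hy ?_ hgy⟩
  exact (hgy.differentiableAt (by simp)).hasDerivAt

open Topology in
/-- First-order Taylor expansion of a `C²` function with quadratic remainder. -/
theorem ContDiffAt.isBigO_sub_taylor_one {f : ℝ → ℝ} {f' a : ℝ} (hf : ContDiffAt ℝ 2 f a)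
    (hf' : HasDerivAt f f' a) :
    (fun x => f x - f a - f' * (x - a)) =O[𝓝 a] fun x => (x - a) ^ 2 := by
  obtain ⟨u, hu, hfu⟩ := hf.contDiffOn (m := 2) le_rfl (by simp)
  obtain ⟨r, hr, hru⟩ := Metric.mem_nhds_iff.1 hu
  have hmem := Metric.mem_ball_self (x := a) hr
  have ho := taylor_isLittleO (n := 2) (convex_ball a r) hmem (hfu.mono hru)
  rw [Metric.isOpen_ball.nhdsWithin_eq hmem] at ho
  have hd : derivWithin f (Metric.ball a r) a = f' := by
    rw [derivWithin_of_isOpen Metric.isOpen_ball hmem, hf'.deriv]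
  have hq := (isBigO_refl (fun x : ℝ => (x - a) ^ 2) (𝓝 a)).const_mul_left
    (((2 : ℝ))⁻¹ * iteratedDerivWithin 2 f (Metric.ball a r) a)
  refine (ho.isBigO.add hq).congr_left fun x => ?_
  simp [taylorWithinEval_succ, taylor_within_zero_eval, iteratedDerivWithin_one, hd]
  ring

/-- **Critical point of the flat-bilayer ODE system.** For a double-well potential `W`
with `W(−1) = 0`, `W'(−1) = 0` and `μ₋ = W''(−1) > 0`, there are smooth branches
`u₋(ε), v₋(ε)` with `u₋(0) = −1`, `v₋(0) = −γ/μ₋` such that `(u₋(ε), 0, v₋(ε), 0)` is a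
critical point of the flat-bilayer ODE system, and the far-field amphiphile density
satisfies `1 + u₋(ε) = (γ/μ₋²) ε + O(ε²)`. -/
theorem flat_bilayer_critical_point
    (W : ℝ → ℝ) (hW : ContDiff ℝ (⊤ : ℕ∞) W)
    (hWm1 : W (-1) = 0) (hW'm1 : deriv W (-1) = 0)
    (hμm : 0 < iteratedDeriv 2 W (-1))
    (γ η1 ηd : ℝ) :
    ∃ ε0 > (0:ℝ), ∃ um vm : ℝ → ℝ,
      ContDiffOn ℝ (⊤ : ℕ∞) um (Set.Ioo (-ε0) ε0) ∧
      ContDiffOn ℝ (⊤ : ℕ∞) vm (Set.Ioo (-ε0) ε0) ∧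
      um 0 = -1 ∧ vm 0 = -γ / iteratedDeriv 2 W (-1) ∧
      (∀ ε ∈ Set.Ioo (-ε0) ε0,
        deriv W (um ε) + ε * vm ε = 0 ∧
        iteratedDeriv 2 W (um ε) * vm ε + γ - ηd * deriv W (um ε) - ε * η1 * vm ε = 0) ∧
      (fun ε => 1 + um ε - (γ / (iteratedDeriv 2 W (-1)) ^ 2) * ε)
        =O[nhds (0:ℝ)] (fun ε => ε ^ 2) := by
  set μ := iteratedDeriv 2 W (-1) with hμ
  rcases eq_or_ne γ 0 with rfl | hγ
  · refine ⟨1, one_pos, fun _ => -1, fun _ => 0, contDiffOn_const, contDiffOn_const, rfl,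
      by simp, fun ε _ => by simp [hW'm1], ?_⟩
    simpa using isBigO_zero (fun ε : ℝ => ε ^ 2) (nhds 0)
  have hA : ContDiff ℝ (⊤ : ℕ∞) (deriv W) := ContDiff.deriv' (by simpa using hW)
  have hBA : iteratedDeriv 2 W = deriv (deriv W) := by
    rw [iteratedDeriv_succ, iteratedDeriv_one]
  have hB : ContDiff ℝ (⊤ : ℕ∞) (iteratedDeriv 2 W) := by
    rw [hBA]
    exact ContDiff.deriv' (by simpa using hA)
  have hdA : HasDerivAt (deriv W) μ (-1) := by
    rw [hμ, hBA]
    exact (hA.differentiable (by simp) _).hasDerivAt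
  have hdB : HasDerivAt (iteratedDeriv 2 W) (deriv (iteratedDeriv 2 W) (-1)) (-1) :=
    (hB.differentiable (by simp) _).hasDerivAt
  -- Eliminating `v` leaves an equation that is affine in `ε`; `g u` is its solution.
  set d : ℝ → ℝ := fun u => γ - (ηd - η1) * deriv W u with hd
  have hdc : ContDiff ℝ (⊤ : ℕ∞) d := contDiff_const.sub (contDiff_const.mul hA)
  have hd1 : d (-1) = γ := by simp [hd, hW'm1]
  have hd0 : ∀ᶠ u in nhds (-1), d u ≠ 0 :=
    hdc.continuous.continuousAt.eventually_ne (by rwa [hd1])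
  set g : ℝ → ℝ := fun u => deriv W u * iteratedDeriv 2 W u / d u with hg
  have hg1 : g (-1) = 0 := by simp [hg, hW'm1]
  have hgs : ∀ᶠ u in nhds (-1), ContDiffAt ℝ (⊤ : ℕ∞) g u := by
    filter_upwards [hd0] with u hu
    exact (hA.mul hB).contDiffAt.div hdc.contDiffAt hu
  have hg' : HasDerivAt g (μ ^ 2 / γ) (-1) := by
    have hdd : HasDerivAt d (deriv d (-1)) (-1) := (hdc.differentiable (by simp) _).hasDerivAt
    convert! (hdA.mul hdB).div hdd hd0.self_of_nhds using 1
    simp only [Pi.mul_apply, hW'm1, hd1, ← hμ]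
    field_simp
    ring
  obtain ⟨h, hh1, hhd, hev⟩ := exists_local_inverse_eventually_contDiffAt hgs hg'
    (div_ne_zero (pow_ne_zero 2 hμm.ne') hγ)
  rw [hg1] at hh1 hhd hev
  have hD : ∀ᶠ ε in nhds (0 : ℝ), iteratedDeriv 2 W (h ε) - ε * η1 ≠ 0 := by
    have hc : ContinuousAt (fun ε => iteratedDeriv 2 W (h ε) - ε * η1) 0 :=
      (hB.continuous.continuousAt.comp hhd.continuousAt).sub (by fun_prop)
    exact hc.eventually_ne (by simpa [hh1] using hμm.ne')
  have hd0' : ∀ᶠ ε in nhds (0 : ℝ), d (h ε) ≠ 0 := by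
    rw [← hh1] at hd0
    exact hhd.continuousAt.eventually hd0
  obtain ⟨r, hr, hball⟩ := Metric.eventually_nhds_iff_ball.1 (hev.and (hD.and hd0'))
  simp only [Real.ball_eq_Ioo, zero_sub, zero_add] at hball
  refine ⟨r, hr, h, fun ε => (ηd * deriv W (h ε) - γ) / (iteratedDeriv 2 W (h ε) - ε * η1),
    fun ε hε => (hball ε hε).1.2.contDiffWithinAt, fun ε hε => ?_, hh1,
    by simp [hh1, hW'm1, hμ], fun ε hε => ?_, ?_⟩
  · obtain ⟨⟨-, hs⟩, hne, -⟩ := hball ε hε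
    have hAh := hA.contDiffAt.comp ε hs
    have hBh := hB.contDiffAt.comp ε hs
    exact (((contDiffAt_const.mul hAh).sub contDiffAt_const).div
      (hBh.sub (contDiffAt_id.mul contDiffAt_const)) hne).contDiffWithinAt
  · obtain ⟨⟨hgh, -⟩, hne, hdne⟩ := hball ε hε
    rw [hg, div_eq_iff hdne] at hgh
    simp only [hd] at hgh
    constructor
    · rw [mul_div_assoc', add_div' _ _ _ hne, div_eq_zero_iff]
      left
      linear_combination hgh
    · have := div_mul_cancel₀ (ηd * deriv W (h ε) - γ) hne
      linear_combination this
  · have hs : ContDiffAt ℝ 2 h 0 :=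
      hev.self_of_nhds.2.of_le (WithTop.coe_le_coe.2 (le_top : (2 : ℕ∞) ≤ ⊤))
    have hO := hs.isBigO_sub_taylor_one hhd
    simpa [hh1, add_comm] using hO
end

section
/- Let ν1, ν2 ∈ ℝ. In the polynomial ring ℂ[C1, C2, C̄1, C̄2, D1, D2, D3, D4] set c_{1,+} = (C1 + C̄1)/2, c_{1,−} = (C1 − C̄1)/(2i), c_{2,−} = (C2 − C̄2)/(2i), and define R_{2,2} = 2ν1(−c_{1,+}² − 6 c_{1,+} c_{2,−} + 2 c_{1,−}² + 7 c_{2,−}²) + ν2((1/2) D1² + D2² + 2 D1 D3) and R_{2,8} = 8ν2[(c_{1,+} + 3 c_{2,−}) D1 + 2 c_{1,−} D2 − 2(c_{1,+} − c_{2,−}) D3]. Let R2 be the 8-tuple (0, R_{2,2}, 0, R̄_{2,2}, 0, 0, 0, R_{2,8}), where R̄_{2,2} is obtained from R_{2,2} by conjugating coefficients and interchanging C1 ↔ C̄1, C2 ↔ C̄2 (which here equals R_{2,2} itself). Let 𝒟 be the derivation 𝒟 = (iC1 + C2)∂_{C1} + iC2∂_{C2} + (−iC̄1 + C̄2)∂_{C̄1}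 + (−iC̄2)∂_{C̄2} + D2∂_{D1} + D3∂_{D2} + D4∂_{D3}, and let L0 act on 8-tuples of polynomials by (Φ1,…,Φ8) ↦ (iΦ1 + Φ2, iΦ2, −iΦ3 + Φ4, −iΦ4, Φ6, Φ7, Φ8, 0). Then there exists an 8-tuple Φ2 = (Φ_{2,1},…,Φ_{2,8}) of homogeneous degree-2 polynomials such that 𝒟Φ_{2,j} − (L0Φ2)_j = (R2)_j for j = 1,…,8. In particular R2 lies in the range of the homological operator 𝒟 − L0 on quadratic vector fields, so the quadratic term 𝓡₂ of the normal form vanishes. -/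
noncomputable section

open MvPolynomial

/-- The homological derivation
`𝒟 = (iC1 + C2)∂_{C1} + iC2∂_{C2} + (−iC̄1 + C̄2)∂_{C̄1} + (−iC̄2)∂_{C̄2}
   + D2∂_{D1} + D3∂_{D2} + D4∂_{D3}`
on `ℂ[C1, C2, C̄1, C̄2, D1, D2, D3, D4]`, with the eight variables indexed `0,…,7` as
`C1, C2, C̄1, C̄2, D1, D2, D3, D4`. -/
def Dcal (p : MvPolynomial (Fin 8) ℂ) : MvPolynomial (Fin 8) ℂ :=
  (C Complex.I * X 0 + X 1) * pderiv 0 p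
    + (C Complex.I * X 1) * pderiv 1 p
    + (-(C Complex.I) * X 2 + X 3) * pderiv 2 p
    + (-(C Complex.I) * X 3) * pderiv 3 p
    + X 5 * pderiv 4 p
    + X 6 * pderiv 5 p
    + X 7 * pderiv 6 p

/-- `c_{1,+} = (C1 + C̄1)/2`. -/
def c1plus : MvPolynomial (Fin 8) ℂ := C (1/2 : ℂ) * (X 0 + X 2)

/-- `c_{1,−} = (C1 − C̄1)/(2i)`. -/
def c1minus : MvPolynomial (Fin 8) ℂ := C (1/(2 * Complex.I)) * (X 0 - X 2)

/-- `c_{2,−} = (C2 − C̄2)/(2i)`. -/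
def c2minus : MvPolynomial (Fin 8) ℂ := C (1/(2 * Complex.I)) * (X 1 - X 3)

/-- The quadratic term `R_{2,2}` of the reduced system. -/
def R22 (ν1 ν2 : ℝ) : MvPolynomial (Fin 8) ℂ :=
  C ((2 * ν1 : ℝ) : ℂ) *
      (-(c1plus ^ 2) - 6 * c1plus * c2minus + 2 * c1minus ^ 2 + 7 * c2minus ^ 2)
    + C ((ν2 : ℝ) : ℂ) * (C (1/2 : ℂ) * X 4 ^ 2 + X 5 ^ 2 + 2 * X 4 * X 6)

/-- The quadratic term `R_{2,8}` of the reduced system. -/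
def R28 (ν2 : ℝ) : MvPolynomial (Fin 8) ℂ :=
  C ((8 * ν2 : ℝ) : ℂ) *
    ((c1plus + 3 * c2minus) * X 4 + 2 * c1minus * X 5 - 2 * (c1plus - c2minus) * X 6)

/-- `Dcal` as a derivation. -/
def homologicalDerivation :
    Derivation ℂ (MvPolynomial (Fin 8) ℂ) (MvPolynomial (Fin 8) ℂ) :=
  (C Complex.I * X 0 + X 1 : MvPolynomial (Fin 8) ℂ) • pderiv 0
    + (C Complex.I * X 1 : MvPolynomial (Fin 8) ℂ) • pderiv 1
    + (-(C Complex.I) * X 2 + X 3 : MvPolynomial (Fin 8) ℂ) • pderiv 2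
    + (-(C Complex.I) * X 3 : MvPolynomial (Fin 8) ℂ) • pderiv 3
    + (X 5 : MvPolynomial (Fin 8) ℂ) • pderiv 4
    + (X 6 : MvPolynomial (Fin 8) ℂ) • pderiv 5
    + (X 7 : MvPolynomial (Fin 8) ℂ) • pderiv 6

theorem homologicalDerivation_apply (p : MvPolynomial (Fin 8) ℂ) :
    homologicalDerivation p = Dcal p := by
  simp [homologicalDerivation, Dcal]

section GeneralizedEigenspaces

variable {K A : Type*} [Field K] [CommRing A] [Algebra K A]

theorem Derivation.pow_sub_smul_mul_eq_zero (d : Derivation K A A) (a b : K) :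
    ∀ (n k l : ℕ) (p q : A), k + l ≤ n →
      (((d : A →ₗ[K] A) - a • (1 : Module.End K A)) ^ k) p = 0 →
      (((d : A →ₗ[K] A) - b • (1 : Module.End K A)) ^ l) q = 0 →
      (((d : A →ₗ[K] A) - (a + b) • (1 : Module.End K A)) ^ n) (p * q) = 0 := by
  intro n
  induction n with
  | zero =>
    intro k l p q hn hp hq
    obtain rfl : k = 0 := by omega
    have : p = 0 := by simpa using hp
    simp [this]
  | succ n ih =>
    intro k l p q hn hp hq
    rcases k with _ | k
    · have : p = 0 := by simpa using hp
      simp [this]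
    rcases l with _ | l
    · have : q = 0 := by simpa using hq
      simp [this]
    have leibniz : ((d : A →ₗ[K] A) - (a + b) • (1 : Module.End K A)) (p * q)
        = ((d : A →ₗ[K] A) - a • (1 : Module.End K A)) p * q
          + p * ((d : A →ₗ[K] A) - b • (1 : Module.End K A)) q := by
      simp [Algebra.smul_def]
      ring
    rw [pow_succ, Module.End.mul_apply, leibniz, map_add]
    rw [pow_succ, Module.End.mul_apply] at hp hq
    rw [ih k (l + 1) _ _ (by omega) hp (by rw [pow_succ, Module.End.mul_apply, hq]),
      ih (k + 1) l _ _ (by omega) (by rw [pow_succ, Module.End.mul_apply, hp]) hq, add_zero]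

theorem Derivation.mul_mem_maxGenEigenspace (d : Derivation K A A) {a b : K} {p q : A}
    (hp : p ∈ Module.End.maxGenEigenspace (d : A →ₗ[K] A) a)
    (hq : q ∈ Module.End.maxGenEigenspace (d : A →ₗ[K] A) b) :
    p * q ∈ Module.End.maxGenEigenspace (d : A →ₗ[K] A) (a + b) := by
  rw [Module.End.mem_maxGenEigenspace] at *
  obtain ⟨k, hk⟩ := hp
  obtain ⟨l, hl⟩ := hq
  exact ⟨k + l, d.pow_sub_smul_mul_eq_zero a b _ k l p q le_rfl hk hl⟩

variable {V : Type*} [AddCommGroup V] [Module K V]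

/-- Away from the eigenvalue `a`, the operator `T - b` is onto on the part of an invariant
submodule that lies in the generalized eigenspace of `a`. -/
theorem Module.End.inf_maxGenEigenspace_le_map (T : Module.End K V) (W : Submodule K V)
    (hW : ∀ v ∈ W, T v ∈ W) {a b : K} (hab : a ≠ b) :
    W ⊓ T.maxGenEigenspace a ≤ (W ⊓ T.maxGenEigenspace a).map (T - b • 1) := by
  have key : ∀ (k : ℕ), ∀ p ∈ W, ((T - a • 1) ^ k) p = 0 →
      ∃ q ∈ W, ((T - a • 1) ^ k) q = 0 ∧ (T - b • 1) q = p := by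
    intro k
    induction k with
    | zero =>
      intro p _ hp
      have : p = 0 := by simpa using hp
      exact ⟨0, W.zero_mem, by simp, by simp [this]⟩
    | succ k ih =>
      intro p hpW hp
      obtain ⟨q, hqW, hq, hqp⟩ := ih ((T - a • 1) p)
        (W.sub_mem (hW p hpW) (W.smul_mem a hpW)) (by rwa [pow_succ] at hp)
      refine ⟨(a - b)⁻¹ • (p - q), W.smul_mem _ (W.sub_mem hpW hqW), ?_, ?_⟩
      · have : ((T - a • 1) ^ (k + 1)) q = 0 := by
          rw [pow_succ', Module.End.mul_apply, hq, map_zero]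
        rw [map_smul, map_sub, hp, this, sub_zero, smul_zero]
      · rw [map_smul, map_sub, hqp, inv_smul_eq_iff₀ (sub_ne_zero.2 hab)]
        simp [sub_smul]
  rintro p ⟨hpW, hp⟩
  obtain ⟨k, hk⟩ := Module.End.mem_maxGenEigenspace _ _ _ |>.1 hp
  obtain ⟨q, hqW, hq, hqp⟩ := key k p hpW hk
  exact ⟨q, ⟨hqW, Module.End.mem_maxGenEigenspace _ _ _ |>.2 ⟨k, hq⟩⟩, hqp⟩

end GeneralizedEigenspaces

theorem Dcal_isHomogeneous {n : ℕ} {p : MvPolynomial (Fin 8) ℂ} (hp : p.IsHomogeneous n) :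
    (Dcal p).IsHomogeneous n := by
  rcases n with _ | n
  · obtain ⟨c, rfl⟩ : ∃ c, p = C c :=
      ⟨_, totalDegree_eq_zero_iff_eq_C.1 (Nat.le_zero.1 hp.totalDegree_le)⟩
    simpa [Dcal] using isHomogeneous_zero _ _ _
  have hd (i : Fin 8) {l : MvPolynomial (Fin 8) ℂ} (hl : l.IsHomogeneous 1) :
      (l * pderiv i p).IsHomogeneous (n + 1) := by
    have := hl.mul (hp.pderiv (i := i))
    rwa [Nat.add_sub_cancel, add_comm] at this
  have hX (i : Fin 8) : (X i : MvPolynomial (Fin 8) ℂ).IsHomogeneous 1 := isHomogeneous_X _ _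
  have hI (i : Fin 8) : (C Complex.I * X i : MvPolynomial (Fin 8) ℂ).IsHomogeneous 1 :=
    (hX i).C_mul _
  have hnegI (i : Fin 8) : (-(C Complex.I) * X i : MvPolynomial (Fin 8) ℂ).IsHomogeneous 1 := by
    rw [neg_mul]
    exact (hI i).neg
  exact ((((((hd 0 ((hI 0).add (hX 1))).add (hd 1 (hI 1))).add
    (hd 2 ((hnegI 2).add (hX 3)))).add (hd 3 (hnegI 3))).add (hd 4 (hX 5))).add
    (hd 5 (hX 6))).add (hd 6 (hX 7))

/-- Homogeneous polynomials of degree `n` in the generalized eigenspace of `𝒟` for `a`. -/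
def weightSubmodule (n : ℕ) (a : ℂ) : Submodule ℂ (MvPolynomial (Fin 8) ℂ) :=
  homogeneousSubmodule (Fin 8) ℂ n ⊓
    Module.End.maxGenEigenspace (homologicalDerivation : _ →ₗ[ℂ] MvPolynomial (Fin 8) ℂ) a

theorem weightSubmodule_mul_le (m n : ℕ) (a b : ℂ) :
    weightSubmodule m a * weightSubmodule n b ≤ weightSubmodule (m + n) (a + b) :=
  Submodule.mul_le.2 fun _ hp _ hq =>
    ⟨IsHomogeneous.mul hp.1 hq.1, homologicalDerivation.mul_mem_maxGenEigenspace hp.2 hq.2⟩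

/-- `𝒟 - b` maps `W` onto a submodule containing `W`. -/
def IsDcalSolvable (b : ℂ) (W : Submodule ℂ (MvPolynomial (Fin 8) ℂ)) : Prop :=
  W ≤ W.map ((homologicalDerivation : Module.End ℂ (MvPolynomial (Fin 8) ℂ)) - b • 1)

theorem isDcalSolvable_weightSubmodule (n : ℕ) {a b : ℂ} (hab : a ≠ b) :
    IsDcalSolvable b (weightSubmodule n a) :=
  Module.End.inf_maxGenEigenspace_le_map _ _
    (fun p hp => (homologicalDerivation_apply p).symm ▸ Dcal_isHomogeneous hp) hab

theorem IsDcalSolvable.sup {b : ℂ} {W W' : Submodule ℂ (MvPolynomial (Fin 8) ℂ)}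
    (h : IsDcalSolvable b W) (h' : IsDcalSolvable b W') : IsDcalSolvable b (W ⊔ W') := by
  rw [IsDcalSolvable, Submodule.map_sup]
  exact sup_le_sup h h'

theorem IsDcalSolvable.exists_Dcal_sub_eq {b : ℂ} {W : Submodule ℂ (MvPolynomial (Fin 8) ℂ)}
    (h : IsDcalSolvable b W) {p : MvPolynomial (Fin 8) ℂ} (hp : p ∈ W) :
    ∃ q ∈ W, Dcal q - C b * q = p := by
  obtain ⟨q, hq, hqp⟩ := h hp
  refine ⟨q, hq, ?_⟩
  rw [← hqp, ← homologicalDerivation_apply, ← smul_eq_C_mul]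
  rfl

theorem X_mem_weightSubmodule {i : Fin 8} {a : ℂ} (k : ℕ)
    (h : (((homologicalDerivation : Module.End ℂ (MvPolynomial (Fin 8) ℂ)) - a • 1) ^ k)
      (X i) = 0) : X i ∈ weightSubmodule 1 a :=
  ⟨isHomogeneous_X _ _, (Module.End.mem_maxGenEigenspace _ _ _).2 ⟨k, h⟩⟩

/-- The linear forms in `C1, C2, C̄1, C̄2`. -/
def oscillatoryForms : Submodule ℂ (MvPolynomial (Fin 8) ℂ) :=
  weightSubmodule 1 Complex.I ⊔ weightSubmodule 1 (-Complex.I)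

/-- The quadratic forms of even weight. -/
def evenForms : Submodule ℂ (MvPolynomial (Fin 8) ℂ) :=
  weightSubmodule 2 (Complex.I + Complex.I) ⊔ weightSubmodule 2 0
    ⊔ weightSubmodule 2 (-Complex.I + -Complex.I)

/-- The quadratic forms of odd weight. -/
def oddForms : Submodule ℂ (MvPolynomial (Fin 8) ℂ) :=
  weightSubmodule 2 Complex.I ⊔ weightSubmodule 2 (-Complex.I)

theorem mul_mem_evenForms {p q : MvPolynomial (Fin 8) ℂ} (hp : p ∈ oscillatoryForms)
    (hq : q ∈ oscillatoryForms) : p * q ∈ evenForms := by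
  have h0 : weightSubmodule 2 0 ≤ evenForms := le_sup_right.trans le_sup_left
  refine (?_ : oscillatoryForms * oscillatoryForms ≤ evenForms) (Submodule.mul_mem_mul hp hq)
  rw [oscillatoryForms, Submodule.sup_mul, Submodule.mul_sup, Submodule.mul_sup]
  refine sup_le (sup_le ?_ ?_) (sup_le ?_ ?_)
  · exact (weightSubmodule_mul_le _ _ _ _).trans (le_sup_left.trans le_sup_left)
  · refine (weightSubmodule_mul_le _ _ _ _).trans ?_
    rwa [add_neg_cancel]
  · refine (weightSubmodule_mul_le _ _ _ _).trans ?_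
    rwa [neg_add_cancel]
  · exact (weightSubmodule_mul_le _ _ _ _).trans le_sup_right

theorem mul_mem_evenForms_of_weight_zero {p q : MvPolynomial (Fin 8) ℂ}
    (hp : p ∈ weightSubmodule 1 0) (hq : q ∈ weightSubmodule 1 0) : p * q ∈ evenForms := by
  have h := weightSubmodule_mul_le _ _ _ _ (Submodule.mul_mem_mul hp hq)
  rw [add_zero] at h
  exact (le_sup_right.trans le_sup_left : weightSubmodule 2 0 ≤ evenForms) h

theorem mul_mem_oddForms {p q : MvPolynomial (Fin 8) ℂ} (hp : p ∈ oscillatoryForms)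
    (hq : q ∈ weightSubmodule 1 0) : p * q ∈ oddForms := by
  refine (?_ : oscillatoryForms * weightSubmodule 1 0 ≤ oddForms) (Submodule.mul_mem_mul hp hq)
  rw [oscillatoryForms, Submodule.sup_mul]
  refine sup_le_sup ?_ ?_ <;>
  · refine (weightSubmodule_mul_le _ _ _ _).trans ?_
    rw [add_zero]

theorem X_mem_oscillatoryForms :
    X 0 ∈ oscillatoryForms ∧ X 1 ∈ oscillatoryForms ∧
      X 2 ∈ oscillatoryForms ∧ X 3 ∈ oscillatoryForms := by
  refine ⟨Submodule.mem_sup_left (X_mem_weightSubmodule 2 ?_),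
    Submodule.mem_sup_left (X_mem_weightSubmodule 1 ?_),
    Submodule.mem_sup_right (X_mem_weightSubmodule 2 ?_),
    Submodule.mem_sup_right (X_mem_weightSubmodule 1 ?_)⟩ <;>
  simp [pow_succ, homologicalDerivation_apply, Dcal, pderiv_X, smul_eq_C_mul]

theorem X_mem_weightSubmodule_zero :
    X 4 ∈ weightSubmodule 1 0 ∧ X 5 ∈ weightSubmodule 1 0 ∧ X 6 ∈ weightSubmodule 1 0 := by
  refine ⟨X_mem_weightSubmodule 4 ?_, X_mem_weightSubmodule 3 ?_, X_mem_weightSubmodule 2 ?_⟩ <;>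
  simp [pow_succ, homologicalDerivation_apply, Dcal, pderiv_X]

theorem C_mul_mem {W : Submodule ℂ (MvPolynomial (Fin 8) ℂ)} (c : ℂ)
    {p : MvPolynomial (Fin 8) ℂ} (hp : p ∈ W) : C c * p ∈ W :=
  smul_eq_C_mul p c ▸ W.smul_mem c hp

theorem c1plus_mem : c1plus ∈ oscillatoryForms :=
  C_mul_mem _ (add_mem X_mem_oscillatoryForms.1 X_mem_oscillatoryForms.2.2.1)

theorem c1minus_mem : c1minus ∈ oscillatoryForms :=
  C_mul_mem _ (sub_mem X_mem_oscillatoryForms.1 X_mem_oscillatoryForms.2.2.1)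

theorem c2minus_mem : c2minus ∈ oscillatoryForms :=
  C_mul_mem _ (sub_mem X_mem_oscillatoryForms.2.1 X_mem_oscillatoryForms.2.2.2)

theorem R22_mem_evenForms (ν1 ν2 : ℝ) : R22 ν1 ν2 ∈ evenForms := by
  obtain ⟨h4, h5, h6⟩ := X_mem_weightSubmodule_zero
  have hplus := mul_mem_evenForms c1plus_mem c1plus_mem
  have hmixed := mul_mem_evenForms c1plus_mem c2minus_mem
  have hminus := mul_mem_evenForms c1minus_mem c1minus_mem
  have hminus' := mul_mem_evenForms c2minus_mem c2minus_mem
  have h44 := mul_mem_evenForms_of_weight_zero h4 h4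
  have h55 := mul_mem_evenForms_of_weight_zero h5 h5
  have h46 := mul_mem_evenForms_of_weight_zero h4 h6
  have h := add_mem
    (C_mul_mem ((2 * ν1 : ℝ) : ℂ) (add_mem (add_mem (sub_mem (neg_mem hplus)
      (C_mul_mem 6 hmixed)) (C_mul_mem 2 hminus)) (C_mul_mem 7 hminus')))
    (C_mul_mem (ν2 : ℂ) (add_mem (add_mem (C_mul_mem (1 / 2) h44) h55) (C_mul_mem 2 h46)))
  convert h using 1
  simp only [R22, map_ofNat]
  ring

theorem R28_mem_oddForms (ν2 : ℝ) : R28 ν2 ∈ oddForms := by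
  obtain ⟨h4, h5, h6⟩ := X_mem_weightSubmodule_zero
  have h := C_mul_mem ((8 * ν2 : ℝ) : ℂ) (sub_mem (add_mem
    (mul_mem_oddForms (add_mem c1plus_mem (C_mul_mem 3 c2minus_mem)) h4)
    (C_mul_mem 2 (mul_mem_oddForms c1minus_mem h5)))
    (C_mul_mem 2 (mul_mem_oddForms (sub_mem c1plus_mem c2minus_mem) h6)))
  convert h using 1
  simp only [R28, map_ofNat]
  ring

theorem isDcalSolvable_I_evenForms : IsDcalSolvable Complex.I evenForms := by
  refine ((isDcalSolvable_weightSubmodule 2 ?_).sup (isDcalSolvable_weightSubmodule 2 ?_)).sup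
    (isDcalSolvable_weightSubmodule 2 ?_) <;> norm_num [Complex.ext_iff]

theorem isDcalSolvable_neg_I_evenForms : IsDcalSolvable (-Complex.I) evenForms := by
  refine ((isDcalSolvable_weightSubmodule 2 ?_).sup (isDcalSolvable_weightSubmodule 2 ?_)).sup
    (isDcalSolvable_weightSubmodule 2 ?_) <;> norm_num [Complex.ext_iff]

theorem isDcalSolvable_zero_oddForms : IsDcalSolvable 0 oddForms := by
  refine (isDcalSolvable_weightSubmodule 2 ?_).sup (isDcalSolvable_weightSubmodule 2 ?_) <;>
    norm_num [Complex.ext_iff]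

theorem isHomogeneous_of_mem_evenForms {p : MvPolynomial (Fin 8) ℂ} (hp : p ∈ evenForms) :
    p.IsHomogeneous 2 :=
  (sup_le (sup_le inf_le_left inf_le_left) inf_le_left :
    evenForms ≤ homogeneousSubmodule (Fin 8) ℂ 2) hp

theorem isHomogeneous_of_mem_oddForms {p : MvPolynomial (Fin 8) ℂ} (hp : p ∈ oddForms) :
    p.IsHomogeneous 2 :=
  (sup_le inf_le_left inf_le_left : oddForms ≤ homogeneousSubmodule (Fin 8) ℂ 2) hp

/-- **Solvability of the quadratic homological equation (`𝓡₂ = 0`).** There is an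
8-tuple `Φ₂` of homogeneous quadratic polynomials with `𝒟Φ₂ − L0Φ₂ = R₂`, where
`R₂ = (0, R_{2,2}, 0, R̄_{2,2}, 0, 0, 0, R_{2,8})` (and here `R̄_{2,2} = R_{2,2}`), and
`L0` acts by `(Φ1,…,Φ8) ↦ (iΦ1+Φ2, iΦ2, −iΦ3+Φ4, −iΦ4, Φ6, Φ7, Φ8, 0)`; i.e. `R₂` lies
in the range of the homological operator `𝒟 − L0`, so the quadratic term of the normal
form vanishes. -/
theorem quadratic_homological_equation_solvable (ν1 ν2 : ℝ) :
    ∃ Φ : Fin 8 → MvPolynomial (Fin 8) ℂ,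
      (∀ j, (Φ j).IsHomogeneous 2) ∧
      Dcal (Φ 0) - (C Complex.I * Φ 0 + Φ 1) = 0 ∧
      Dcal (Φ 1) - C Complex.I * Φ 1 = R22 ν1 ν2 ∧
      Dcal (Φ 2) - (-(C Complex.I) * Φ 2 + Φ 3) = 0 ∧
      Dcal (Φ 3) - (-(C Complex.I) * Φ 3) = R22 ν1 ν2 ∧
      Dcal (Φ 4) - Φ 5 = 0 ∧
      Dcal (Φ 5) - Φ 6 = 0 ∧
      Dcal (Φ 6) - Φ 7 = 0 ∧
      Dcal (Φ 7) = R28 ν2 := by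
  obtain ⟨p1, hp1, e1⟩ := isDcalSolvable_I_evenForms.exists_Dcal_sub_eq (R22_mem_evenForms ν1 ν2)
  obtain ⟨p0, hp0, e0⟩ := isDcalSolvable_I_evenForms.exists_Dcal_sub_eq hp1
  obtain ⟨p3, hp3, e3⟩ := isDcalSolvable_neg_I_evenForms.exists_Dcal_sub_eq (R22_mem_evenForms ν1 ν2)
  obtain ⟨p2, hp2, e2⟩ := isDcalSolvable_neg_I_evenForms.exists_Dcal_sub_eq hp3
  obtain ⟨p7, hp7, e7⟩ := isDcalSolvable_zero_oddForms.exists_Dcal_sub_eq (R28_mem_oddForms ν2)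
  obtain ⟨p6, hp6, e6⟩ := isDcalSolvable_zero_oddForms.exists_Dcal_sub_eq hp7
  obtain ⟨p5, hp5, e5⟩ := isDcalSolvable_zero_oddForms.exists_Dcal_sub_eq hp6
  obtain ⟨p4, hp4, e4⟩ := isDcalSolvable_zero_oddForms.exists_Dcal_sub_eq hp5
  simp only [map_neg, map_zero, zero_mul, sub_zero] at e2 e3 e4 e5 e6 e7
  refine ⟨![p0, p1, p2, p3, p4, p5, p6, p7], ?_, ?_, e1, ?_, e3, sub_eq_zero.2 e4,
    sub_eq_zero.2 e5, sub_eq_zero.2 e6, e7⟩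
  · intro j
    fin_cases j
    exacts [isHomogeneous_of_mem_evenForms hp0, isHomogeneous_of_mem_evenForms hp1,
      isHomogeneous_of_mem_evenForms hp2, isHomogeneous_of_mem_evenForms hp3,
      isHomogeneous_of_mem_oddForms hp4, isHomogeneous_of_mem_oddForms hp5,
      isHomogeneous_of_mem_oddForms hp6, isHomogeneous_of_mem_oddForms hp7]
  · exact (sub_sub _ _ _).symm.trans (sub_eq_zero.2 e0)
  · exact (sub_sub _ _ _).symm.trans (sub_eq_zero.2 e2)
end
end
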